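/- (Euclidean case of Proposition 4.1.) Let Ω ⊆ ℝ² be open, and let f : Ω → ℝ² be continuous and lie in W^{1,2}_loc(Ω,ℝ²) with weak derivative Df. Suppose there is a measurable K : Ω → ℝ with K(x) ≥ 1, integrable on compact subsets of Ω, such that ‖Df(x)‖² ≤ K(x) · det Df(x) for almost every x ∈ Ω. Let x₀ ∈ Ω, and suppose there are s > 0 with B̄(x₀,s) ⊆ Ω, r₀ ∈ (0,1), and C > 0 such that for all 0 < r < r₀: ∫₀^{2π} N( f(x₀) + r e^{iθ}, f, B(x₀,s) ) dθ ≤ C · log(1/r). Then the connected component of x₀ in the set { x ∈ Ω : f(x) = f(x₀) } either equals {x₀} or contains an open neighborhood of x₀. -/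

import Mathlib

open MeasureTheory Set
open scoped ENNReal Real Topology

noncomputable section

/-- The plane `ℝ²` as a Euclidean space. -/
abbrev E2 : Type := EuclideanSpace ℝ (Fin 2)

/-- `f` lies in `W^{1,2}_loc(Ω, ℝ²)` with weak derivative `Df`. -/
def MemW12loc (Ω : Set E2) (f : E2 → E2) (Df : E2 → E2 →L[ℝ] E2) : Prop :=
  LocallyIntegrableOn f Ω ∧
  Measurable Df ∧
  (∀ A : Set E2, A ⊆ Ω → IsCompact A →
    ∫⁻ x in A, ENNReal.ofReal (‖Df x‖ ^ 2) < ⊤) ∧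
  (∀ φ : E2 → ℝ, ContDiff ℝ (⊤ : ℕ∞) φ → HasCompactSupport φ → tsupport φ ⊆ Ω →
    ∀ i : Fin 2,
      (∫ x in Ω, (fderiv ℝ φ x (EuclideanSpace.single i 1)) • f x) =
        - ∫ x in Ω, φ x • Df x (EuclideanSpace.single i 1))

/-- The multiplicity `N(y, f, A)`, i.e. the cardinality of `{x ∈ A : f x = y}`,
viewed in `[0,∞]`. -/
def mult (f : E2 → E2) (A : Set E2) (y : E2) : ℝ≥0∞ :=
  ((A ∩ f ⁻¹' {y}).encard : ℝ≥0∞)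

/-- The point `r e^{iθ} = (r cos θ, r sin θ)` of `ℝ²`. -/
def circlePt (r θ : ℝ) : E2 :=
  (EuclideanSpace.equiv (Fin 2) ℝ).symm ![r * Real.cos θ, r * Real.sin θ]

namespace CF

def LL (ε t : ℝ) : ℝ := Real.log (1 + 1 / (t + ε))
def chi (ε t : ℝ) : ℝ := 1 / ((t + ε) * LL ε t)

lemma LL_pos {ε t : ℝ} (h : 0 < t + ε) : 0 < LL ε t := by
  apply Real.log_pos
  have : 0 < 1 / (t + ε) := by positivity
  linarith

lemma LL_deriv {ε t : ℝ} (h : 0 < t + ε) :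
    HasDerivAt (LL ε) (-1 / ((t + ε) * (t + ε + 1))) t := by
  have h1 : HasDerivAt (fun t : ℝ => t + ε) 1 t := (hasDerivAt_id t).add_const ε
  have h2 : HasDerivAt (fun t : ℝ => 1 + 1 / (t + ε)) (-1 / (t + ε) ^ 2) t := by
    have := (h1.inv h.ne').const_add 1
    simpa [one_div] using this
  have h3 : (1 + 1 / (t + ε)) ≠ 0 := by positivity
  have h4 : HasDerivAt (LL ε) _ t := h2.log h3
  refine h4.congr_deriv ?_
  field_simp

lemma chi_deriv {ε t : ℝ} (h : 0 < t + ε) :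
    HasDerivAt (chi ε) (-(LL ε t - 1 / (t + ε + 1)) / ((t + ε) * LL ε t) ^ 2) t := by
  have h1 : HasDerivAt (fun t : ℝ => t + ε) 1 t := (hasDerivAt_id t).add_const ε
  have h2 := h1.mul (LL_deriv h)
  have hL := LL_pos h
  have h3 := h2.inv (by simp; exact ⟨h.ne', hL.ne'⟩)
  have h4 : chi ε = ((fun t : ℝ => t + ε) * LL ε)⁻¹ := by
    ext t; simp [chi]
  rw [h4]
  refine h3.congr_deriv ?_
  simp only [Pi.mul_apply]
  congr 1
  field_simp
  ring

def GG (ε : ℝ) (y : E2) : E2 := chi ε (‖y‖ ^ 2) • y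
def VV (ε : ℝ) (y : E2) : ℝ := Real.log (LL ε (‖y‖ ^ 2))

lemma nsq_pos {ε : ℝ} (hε : 0 < ε) (y : E2) : 0 < ‖y‖ ^ 2 + ε := by positivity

lemma LL_contDiff {ε : ℝ} (hε : 0 < ε) :
    ContDiff ℝ (⊤ : ℕ∞) (fun y : E2 => LL ε (‖y‖ ^ 2)) := by
  unfold LL
  apply ContDiff.log
  · apply contDiff_const.add
    apply contDiff_const.div ((contDiff_norm_sq ℝ).add contDiff_const)
    intro y; exact (nsq_pos hε y).ne'
  · intro y; have := nsq_pos hε y; positivity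

lemma GG_contDiff {ε : ℝ} (hε : 0 < ε) : ContDiff ℝ (⊤ : ℕ∞) (GG ε) := by
  unfold GG
  refine ContDiff.smul (f := fun y : E2 => chi ε (‖y‖ ^ 2)) ?_ contDiff_id
  unfold chi
  apply contDiff_const.div
  · exact ((contDiff_norm_sq ℝ).add contDiff_const).mul (LL_contDiff hε)
  · intro y; exact (mul_pos (nsq_pos hε y) (LL_pos (nsq_pos hε y))).ne'

lemma VV_contDiff {ε : ℝ} (hε : 0 < ε) : ContDiff ℝ (⊤ : ℕ∞) (VV ε) := by
  unfold VV
  exact (LL_contDiff hε).log (fun y => (LL_pos (nsq_pos hε y)).ne')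

lemma VV_fderiv_le {ε : ℝ} (hε : 0 < ε) (y : E2) : ‖fderiv ℝ (VV ε) y‖ ≤ 2 * ‖GG ε y‖ := by
  have hs := nsq_pos hε y
  have hL := LL_pos hs
  have h1 : HasFDerivAt (fun y : E2 => ‖y‖ ^ 2) (2 • innerSL ℝ y) y :=
    (hasStrictFDerivAt_norm_sq y).hasFDerivAt
  have h2 := ((LL_deriv hs).comp_hasFDerivAt y h1)
  have h3 := h2.log (by simpa using hL.ne')
  have h4 : HasFDerivAt (VV ε) _ y := h3
  rw [h4.fderiv]
  simp only [Function.comp_apply]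
  rw [norm_smul, norm_smul]
  have h5 : ‖(2 • innerSL ℝ y : E2 →L[ℝ] ℝ)‖ ≤ 2 * ‖y‖ := by
    rw [← Nat.cast_smul_eq_nsmul ℝ, norm_smul]
    simp
  have h6 : ‖GG ε y‖ = ‖y‖ / ((‖y‖ ^ 2 + ε) * LL ε (‖y‖ ^ 2)) := by
    unfold GG chi
    rw [norm_smul, Real.norm_of_nonneg (by positivity)]
    ring
  rw [h6, Real.norm_of_nonneg (by positivity), neg_div, norm_neg,
    Real.norm_of_nonneg (by positivity)]
  calc _ ≤ (LL ε (‖y‖ ^ 2))⁻¹ * (1 / (‖y‖ ^ 2 + ε) * (2 * ‖y‖)) := by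
        gcongr
        nlinarith
    _ = _ := by field_simp

abbrev e (i : Fin 2) : E2 := EuclideanSpace.single i 1

def divG (ε : ℝ) (y : E2) : ℝ :=
  (fderiv ℝ (GG ε) y (e 0)) 0 + (fderiv ℝ (GG ε) y (e 1)) 1

lemma divG_ge {ε : ℝ} (hε : 0 < ε) (hε1 : ε ≤ 1) (y : E2) (hy : ‖y‖ ≤ 1) :
    2 * ‖GG ε y‖ ^ 2 ≤ 3 * divG ε y := by
  have hs := nsq_pos hε y
  have hL := LL_pos hs
  have h1 : HasFDerivAt (fun y : E2 => ‖y‖ ^ 2) (2 • innerSL ℝ y) y :=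
    (hasStrictFDerivAt_norm_sq y).hasFDerivAt
  have h2 := ((chi_deriv hs).comp_hasFDerivAt y h1)
  have h3 : HasFDerivAt (GG ε) _ y := h2.smul (hasFDerivAt_id y)
  have hy2 : ‖y‖ ^ 2 = y 0 ^ 2 + y 1 ^ 2 := by
    rw [EuclideanSpace.norm_sq_eq]; simp
  have h6 : ‖GG ε y‖ ^ 2 = ‖y‖ ^ 2 / ((‖y‖ ^ 2 + ε) * LL ε (‖y‖ ^ 2)) ^ 2 := by
    unfold GG chi
    rw [norm_smul, Real.norm_of_nonneg (by positivity), mul_pow, div_pow]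
    ring
  have h7 : divG ε y = 2 * (ε * LL ε (‖y‖ ^ 2) + ‖y‖ ^ 2 / (‖y‖ ^ 2 + ε + 1)) /
      ((‖y‖ ^ 2 + ε) * LL ε (‖y‖ ^ 2)) ^ 2 := by
    unfold divG
    rw [h3.fderiv]
    simp [chi, EuclideanSpace.inner_single_right]
    have : y 0 ^ 2 = ‖y‖ ^ 2 - y 1 ^ 2 := by linarith
    field_simp
    ring_nf
    simp only [this]
    ring
  rw [h6, h7, ← mul_div_assoc, ← mul_div_assoc]
  have h8 : ‖y‖ ^ 2 ≤ 1 := by nlinarith [norm_nonneg y]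
  have h9 : ‖y‖ ^ 2 / 3 ≤ ‖y‖ ^ 2 / (‖y‖ ^ 2 + ε + 1) := by
    gcongr; linarith
  have h10 : 0 ≤ ε * LL ε (‖y‖ ^ 2) := by positivity
  refine div_le_div_of_nonneg_right ?_ (by positivity)
  linarith

lemma VV_le {ε : ℝ} (hε : 0 < ε) {c : ℝ} (hc : 0 < c) (y : E2) (hy : c ≤ ‖y‖ ^ 2) :
    VV ε y ≤ Real.log (Real.log (1 + 1 / c)) := by
  unfold VV
  apply Real.log_le_log (LL_pos (nsq_pos hε y))
  unfold LL
  apply Real.log_le_log (by positivity)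
  gcongr
  linarith

lemma VV_zero_large (C : ℝ) : ∃ ε : ℝ, 0 < ε ∧ ε ≤ 1 ∧ C < VV ε 0 := by
  have h1 : Filter.Tendsto (fun ε : ℝ => Real.log (Real.log (1 + 1 / ε))) (𝓝[>] 0) Filter.atTop := by
    apply Real.tendsto_log_atTop.comp
    apply Real.tendsto_log_atTop.comp
    apply Filter.tendsto_atTop_add_const_left
    have h0 := tendsto_inv_nhdsGT_zero (𝕜 := ℝ)
    exact h0.congr (fun x => (one_div x).symm)
  have h2 := h1.eventually (Filter.eventually_gt_atTop C)
  have h3 : ∀ᶠ ε : ℝ in 𝓝[>] 0, ε ∈ Ioc (0 : ℝ) 1 := Ioc_mem_nhdsGT (by norm_num)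
  obtain ⟨ε, h, h'⟩ := (h2.and h3).exists
  exact ⟨ε, h'.1, h'.2, by simpa [VV, LL] using h⟩

end CF

namespace CF

open ContinuousLinearMap Filter
open scoped Convolution

abbrev M2 : Type := E2 →L[ℝ] E2

def moll {F : Type*} [NormedAddCommGroup F] [NormedSpace ℝ F] (φ : ContDiffBump (0 : E2))
    (A : E2 → F) : E2 → F :=
  (φ.normed volume ⋆[lsmul ℝ ℝ, volume] A)

lemma sq_lintegral_le {α : Type*} [MeasurableSpace α] (ν : Measure α) [IsProbabilityMeasure ν]
    (h : α → ℝ≥0∞) (hh : AEMeasurable h ν) : (∫⁻ x, h x ∂ν) ^ 2 ≤ ∫⁻ x, h x ^ 2 ∂ν := by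
  have h1 := ENNReal.lintegral_mul_le_Lp_mul_Lq ν (p := 2) (q := 2)
    (Real.HolderConjugate.two_two) hh (aemeasurable_const (b := (1 : ℝ≥0∞)))
  simp at h1
  calc (∫⁻ x, h x ∂ν) ^ 2 ≤ ((∫⁻ x, h x ^ 2 ∂ν) ^ (2 : ℝ)⁻¹) ^ 2 := by gcongr
    _ = _ := by
      rw [← ENNReal.rpow_natCast, ← ENNReal.rpow_mul]; norm_num

lemma moll_contr (φ : ContDiffBump (0 : E2)) (A : E2 → M2) (hA : StronglyMeasurable A) :
    eLpNorm (moll φ A) 2 volume ≤ eLpNorm A 2 volume := by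
  set ν : Measure E2 := volume.withDensity (fun t => ENNReal.ofReal (φ.normed volume t)) with hν
  have hcont : Continuous (φ.normed volume) := φ.continuous_normed
  have hdm : Measurable (fun t => ENNReal.ofReal (φ.normed volume t)) :=
    hcont.measurable.ennreal_ofReal
  have : IsProbabilityMeasure ν := by
    constructor
    rw [hν, withDensity_apply _ MeasurableSet.univ, setLIntegral_univ,
      ← ofReal_integral_eq_lintegral_ofReal φ.integrable_normed
        (Eventually.of_forall φ.nonneg_normed), φ.integral_normed]
    simp
  have hm1 : ∀ x : E2, Measurable (fun t => ‖A (x - t)‖ₑ) := fun x =>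
    (hA.comp_measurable (measurable_const.sub measurable_id)).enorm
  have key : ∀ x, ‖moll φ A x‖ₑ ≤ ∫⁻ t, ‖A (x - t)‖ₑ ∂ν := by
    intro x
    rw [hν, lintegral_withDensity_eq_lintegral_mul _ hdm (hm1 x)]
    refine (enorm_integral_le_lintegral_enorm _).trans (le_of_eq ?_)
    congr 1; ext t
    simp only [lsmul_apply, enorm_smul, Pi.mul_apply]
    congr 1
    rw [Real.enorm_of_nonneg (φ.nonneg_normed t)]
  have h2 : ∫⁻ x, ‖moll φ A x‖ₑ ^ 2 ≤ ∫⁻ x, ‖A x‖ₑ ^ 2 := by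
    calc ∫⁻ x, ‖moll φ A x‖ₑ ^ 2 ≤ ∫⁻ x, ∫⁻ t, ‖A (x - t)‖ₑ ^ 2 ∂ν := by
          apply lintegral_mono; intro x
          refine (pow_le_pow_left' (key x) 2).trans ?_
          exact sq_lintegral_le ν _ (hm1 x).aemeasurable
      _ = ∫⁻ t, (∫⁻ x, ‖A (x - t)‖ₑ ^ 2) ∂ν := by
          rw [lintegral_lintegral_swap]
          apply Measurable.aemeasurable
          exact ((hA.comp_measurable (measurable_fst.sub measurable_snd)).enorm).pow_const 2
      _ = ∫⁻ t, (∫⁻ x, ‖A x‖ₑ ^ 2) ∂ν := by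
          congr 1; ext t
          exact lintegral_sub_right_eq_self (fun x => ‖A x‖ₑ ^ 2) t
      _ = _ := by simp
  rw [eLpNorm_eq_lintegral_rpow_enorm_toReal (by norm_num) (by norm_num),
    eLpNorm_eq_lintegral_rpow_enorm_toReal (by norm_num) (by norm_num)]
  simp only [ENNReal.toReal_ofNat, ENNReal.rpow_ofNat]
  gcongr

lemma moll_exists (φ : ContDiffBump (0 : E2)) {F : Type*} [NormedAddCommGroup F] [NormedSpace ℝ F]
    (A : E2 → F) (hA : LocallyIntegrable A) :
    ConvolutionExists (φ.normed volume) A (lsmul ℝ ℝ) volume :=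
  φ.hasCompactSupport_normed.convolutionExists_left _ φ.continuous_normed hA

lemma moll_cc {φ : ℕ → ContDiffBump (0 : E2)}
    (hφ : Tendsto (fun k => (φ k).rOut) atTop (𝓝 0))
    (h : E2 → M2) (hc : Continuous h) (hs : HasCompactSupport h) :
    Tendsto (fun k => eLpNorm (fun x => moll (φ k) h x - h x) 2 volume) atTop (𝓝 0) := by
  set S := Metric.cthickening 1 (tsupport h) with hS
  have hSc : IsCompact S := hs.cthickening
  have huc := hs.uniformContinuous_of_continuous hc
  rw [ENNReal.tendsto_nhds_zero]
  intro ε hε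
  set m : ℝ≥0∞ := volume S ^ (1 / (2 : ℝ≥0∞).toReal) with hm
  have hmf : m ≠ ⊤ := by
    apply ENNReal.rpow_ne_top_of_nonneg (by simp) hSc.measure_lt_top.ne
  obtain ⟨δ, hδ, hδε⟩ : ∃ δ : ℝ, 0 < δ ∧ ENNReal.ofReal δ * m ≤ ε := by
    obtain ⟨d, hd, hd2⟩ := ENNReal.exists_nnreal_pos_mul_lt hmf hε.ne'
    exact ⟨d, by exact_mod_cast hd, by simpa using hd2.le⟩
  obtain ⟨r, hr, hr2⟩ := Metric.uniformContinuous_iff.1 huc δ hδ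
  have h1 : ∀ᶠ k in atTop, (φ k).rOut < min r 1 :=
    hφ.eventually (gt_mem_nhds (by positivity))
  filter_upwards [h1] with k hk
  have hk1 : (φ k).rOut < r := hk.trans_le (min_le_left _ _)
  have hk2 : (φ k).rOut < 1 := hk.trans_le (min_le_right _ _)
  have hb : ∀ x, ‖moll (φ k) h x - h x‖ ≤ ‖S.indicator (fun _ => δ) x‖ := by
    intro x
    by_cases hx : x ∈ S
    · rw [indicator_of_mem hx, ← dist_eq_norm, Real.norm_of_nonneg hδ.le]
      apply ContDiffBump.dist_normed_convolution_le hc.aestronglyMeasurable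
      intro y hy
      exact (hr2 ((Metric.mem_ball.1 hy).trans hk1)).le
    · rw [indicator_of_notMem hx]
      have hz : ∀ y ∈ Metric.ball x (φ k).rOut, h y = 0 := by
        intro y hy
        by_contra hne
        apply hx
        apply Metric.mem_cthickening_of_dist_le x y _ _ (subset_tsupport h hne)
        rw [dist_comm]
        exact ((Metric.mem_ball.1 hy).trans hk2).le
      have hx0 := hz x (Metric.mem_ball_self (φ k).rOut_pos)
      have : moll (φ k) h x = h x := by
        apply ContDiffBump.normed_convolution_eq_right
        intro y hy
        rw [hz y hy, hx0]
      simp [this]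
  calc _ ≤ eLpNorm (S.indicator (fun _ => δ)) 2 volume := eLpNorm_mono hb
    _ ≤ ‖δ‖ₑ * m := eLpNorm_indicator_const_le _ _
    _ ≤ ε := by rwa [Real.enorm_of_nonneg hδ.le]

lemma moll_L2 {φ : ℕ → ContDiffBump (0 : E2)}
    (hφ : Tendsto (fun k => (φ k).rOut) atTop (𝓝 0))
    (A : E2 → M2) (hA : StronglyMeasurable A) (hA2 : MemLp A 2 volume) :
    Tendsto (fun k => eLpNorm (fun x => moll (φ k) A x - A x) 2 volume) atTop (𝓝 0) := by
  rw [ENNReal.tendsto_nhds_zero]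
  intro ε hε
  obtain ⟨h, hs, hh, hc, hm⟩ := hA2.exists_hasCompactSupport_eLpNorm_sub_le (by norm_num)
    (ε := ε / 3) (by simpa using hε.ne')
  have h1 := (ENNReal.tendsto_nhds_zero.1 (moll_cc hφ h hc hs)) (ε / 3) (by simpa using hε.ne')
  filter_upwards [h1] with k hk
  have e1 : (fun x => moll (φ k) A x - A x) = moll (φ k) (A - h) +
      ((fun x => moll (φ k) h x - h x) + (h - A)) := by
    have l1 : LocallyIntegrable A := hA2.locallyIntegrable (by norm_num)
    have l2 : LocallyIntegrable h := hc.locallyIntegrable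
    have := (moll_exists (φ k) (A - h) (l1.sub l2)).distrib_add (moll_exists (φ k) h l2)
    rw [sub_add_cancel] at this
    ext1 x
    have hx := congrFun this x
    simp only [moll, Pi.add_apply, Pi.sub_apply] at hx ⊢
    rw [hx]; abel
  have cm : ∀ B : E2 → M2, LocallyIntegrable B → AEStronglyMeasurable (moll (φ k) B) volume := by
    intro B hB
    exact ((φ k).hasCompactSupport_normed.continuous_convolution_left _ (φ k).continuous_normed
      hB).aestronglyMeasurable
  have l1 : LocallyIntegrable A := hA2.locallyIntegrable (by norm_num)
  have l2 : LocallyIntegrable h := hc.locallyIntegrable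
  rw [e1]
  refine (eLpNorm_add_le (cm _ (l1.sub l2)) (((cm _ l2).sub hc.aestronglyMeasurable).add
    (hc.aestronglyMeasurable.sub hA2.1)) (by norm_num)).trans ?_
  have t1 : eLpNorm (moll (φ k) (A - h)) 2 volume ≤ ε / 3 :=
    (moll_contr (φ k) _ (hA.sub hc.stronglyMeasurable)).trans hh
  have t2 : eLpNorm (h - A) 2 volume ≤ ε / 3 := by
    rw [eLpNorm_sub_comm]; exact hh
  have t3 := eLpNorm_add_le (p := 2) ((cm _ l2).sub hc.aestronglyMeasurable)
    (hc.aestronglyMeasurable.sub hA2.1) (by norm_num)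
  calc _ ≤ ε / 3 + (ε / 3 + ε / 3) := add_le_add t1 (t3.trans (add_le_add hk t2))
    _ = ε := by rw [← add_assoc, ENNReal.add_thirds]

lemma moll_pair {φ : ℕ → ContDiffBump (0 : E2)}
    (hφ : Tendsto (fun k => (φ k).rOut) atTop (𝓝 0))
    (A : E2 → M2) (hA : StronglyMeasurable A) (hA2 : MemLp A 2 volume)
    {F : Type*} [NormedAddCommGroup F] (b : E2 → F) (hb : MemLp b 2 volume) :
    Tendsto (fun k => ∫⁻ x, ‖moll (φ k) A x - A x‖ₑ * ‖b x‖ₑ) atTop (𝓝 0) := by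
  have h1 := moll_L2 hφ A hA hA2
  have h2 : Tendsto (fun k => eLpNorm (fun x => moll (φ k) A x - A x) 2 volume *
      eLpNorm b 2 volume) atTop (𝓝 0) := by
    have := ENNReal.Tendsto.mul_const h1 (Or.inr hb.2.ne)
    simpa using this
  refine tendsto_of_tendsto_of_tendsto_of_le_of_le tendsto_const_nhds h2 (fun _ => zero_le) ?_
  intro k
  have l1 : LocallyIntegrable A := hA2.locallyIntegrable (by norm_num)
  have cm : AEStronglyMeasurable (moll (φ k) A) volume :=
    ((φ k).hasCompactSupport_normed.continuous_convolution_left _ (φ k).continuous_normed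
      l1).aestronglyMeasurable
  have := ENNReal.lintegral_mul_le_Lp_mul_Lq volume (p := 2) (q := 2)
    (Real.HolderConjugate.two_two) (cm.sub hA2.1).enorm hb.1.enorm
  simp only [Pi.mul_apply, Pi.sub_apply] at this
  refine this.trans (le_of_eq ?_)
  beta_reduce
  rw [eLpNorm_eq_lintegral_rpow_enorm_toReal (by norm_num) (by norm_num),
    eLpNorm_eq_lintegral_rpow_enorm_toReal (by norm_num) (by norm_num)]
  simp

end CF

namespace CF

open ContinuousLinearMap Filter
open scoped Convolution

structure Data (x₀ : E2) (R : ℝ) (g : E2 → E2) (A : E2 → M2) : Prop where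
  hR : 0 < R
  gm : AEStronglyMeasurable g volume
  gc : ContinuousOn g (Metric.closedBall x₀ (2 * R))
  g1 : ∀ x, ‖g x‖ ≤ 1
  Am : StronglyMeasurable A
  A2 : MemLp A 2 volume
  weak : ∀ φ : E2 → ℝ, ContDiff ℝ (⊤ : ℕ∞) φ → HasCompactSupport φ →
    tsupport φ ⊆ Metric.ball x₀ (2 * R) → ∀ i : Fin 2,
      (∫ x, (fderiv ℝ φ x (e i)) • g x) = - ∫ x, φ x • A x (e i)

lemma clm_ext {F : Type*} [NormedAddCommGroup F] [NormedSpace ℝ F] {S T : E2 →L[ℝ] F}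
    (h : ∀ i, S (e i) = T (e i)) : S = T := by
  apply ContinuousLinearMap.coe_injective
  apply (EuclideanSpace.basisFun (Fin 2) ℝ).toBasis.ext
  intro i
  simpa using h i

variable {x₀ : E2} {R : ℝ} {g : E2 → E2} {A : E2 → M2}

lemma Data.gli (D : Data x₀ R g A) : LocallyIntegrable g volume := by
  have : MemLp g ⊤ volume := memLp_top_of_bound D.gm 1 (Eventually.of_forall D.g1)
  exact this.locallyIntegrable le_top

lemma Data.Ali (D : Data x₀ R g A) : LocallyIntegrable A volume :=
  D.A2.locallyIntegrable (by norm_num)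

lemma Data.moll_hasFDerivAt (D : Data x₀ R g A) (φ : ContDiffBump (0 : E2)) (hφ : φ.rOut < R)
    {x : E2} (hx : x ∈ Metric.closedBall x₀ R) :
    HasFDerivAt (moll φ g) (moll φ A x) x := by
  have hρ : ContDiff ℝ (⊤ : ℕ∞) (φ.normed volume) := φ.contDiff_normed
  have h1 := φ.hasCompactSupport_normed.hasFDerivAt_convolution_left (lsmul ℝ ℝ)
    (hρ.of_le (by exact_mod_cast le_top)) D.gli x
  refine h1.congr_fderiv ?_
  apply clm_ext
  intro i
  set ζ : E2 → ℝ := fun t => φ.normed volume (x - t) with hζ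
  have hζc : ContDiff ℝ (⊤ : ℕ∞) ζ := hρ.comp (contDiff_const.sub contDiff_id)
  have hsub : tsupport ζ ⊆ Metric.closedBall x φ.rOut := by
    apply closure_minimal _ Metric.isClosed_closedBall
    intro t ht
    have : x - t ∈ Function.support (φ.normed volume) := ht
    rw [φ.support_normed_eq, mem_ball_zero_iff] at this
    rw [Metric.mem_closedBall, dist_comm, dist_eq_norm]
    exact this.le
  have hζs : HasCompactSupport ζ :=
    (isCompact_closedBall x φ.rOut).of_isClosed_subset (isClosed_tsupport ζ) hsub
  have hw := D.weak ζ hζc hζs (hsub.trans (Metric.closedBall_subset_ball' (by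
    have := Metric.mem_closedBall.1 hx
    linarith))) i
  have hfd : ∀ t, fderiv ℝ ζ t (e i) = - fderiv ℝ (φ.normed volume) (x - t) (e i) := by
    intro t
    have h2 : HasFDerivAt (fun t : E2 => x - t) (-ContinuousLinearMap.id ℝ E2) t :=
      (hasFDerivAt_id t).const_sub x
    have h3 := ((hρ.differentiable (by simp)) (x - t)).hasFDerivAt.comp t h2
    have h4 : HasFDerivAt ζ _ t := h3
    rw [h4.fderiv]; simp
  simp only [hfd, neg_smul, integral_neg, neg_inj] at hw
  rw [convolution_eq_swap]
  have hex : ConvolutionExistsAt (fderiv ℝ (φ.normed volume)) g x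
      ((lsmul ℝ ℝ).precompL E2) volume :=
    (φ.hasCompactSupport_normed.fderiv ℝ).convolutionExists_left _
      (hρ.continuous_fderiv (by simp)) D.gli x
  rw [ContinuousLinearMap.integral_apply hex.integrable_swap]
  unfold moll
  rw [convolution_eq_swap]
  have hex2 : ConvolutionExistsAt (φ.normed volume) A x (lsmul ℝ ℝ) volume :=
    moll_exists φ A D.Ali x
  rw [ContinuousLinearMap.integral_apply hex2.integrable_swap]
  simpa [precompL_apply] using hw

lemma Data.moll_contDiff (D : Data x₀ R g A) (φ : ContDiffBump (0 : E2)) :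
    ContDiff ℝ (⊤ : ℕ∞) (moll φ g) :=
  φ.hasCompactSupport_normed.contDiff_convolution_left _ φ.contDiff_normed D.gli

lemma Data.mollA_cont (D : Data x₀ R g A) (φ : ContDiffBump (0 : E2)) :
    Continuous (moll φ A) :=
  φ.hasCompactSupport_normed.continuous_convolution_left _ φ.continuous_normed D.Ali

lemma Data.moll_le (D : Data x₀ R g A) (φ : ContDiffBump (0 : E2)) (x : E2) :
    ‖moll φ g x‖ ≤ 1 := by
  have := dist_convolution_le (μ := volume) (z₀ := (0 : E2)) (x₀ := x) zero_le_one
    φ.support_normed_eq.subset φ.nonneg_normed φ.integral_normed D.gm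
    (fun y _ => by simpa using D.g1 y)
  simpa [moll] using this

lemma Data.moll_unif (D : Data x₀ R g A) {φ : ℕ → ContDiffBump (0 : E2)}
    (hφ : Tendsto (fun k => (φ k).rOut) atTop (𝓝 0)) :
    TendstoUniformlyOn (fun k => moll (φ k) g) g atTop (Metric.closedBall x₀ R) := by
  rw [Metric.tendstoUniformlyOn_iff]
  intro ε hε
  have huc := (isCompact_closedBall x₀ (2 * R)).uniformContinuousOn_of_continuous D.gc
  obtain ⟨r, hr, hr2⟩ := Metric.uniformContinuousOn_iff.1 huc (ε / 2) (by positivity)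
  have hR := D.hR
  have h1 : ∀ᶠ k in atTop, (φ k).rOut < min r R :=
    hφ.eventually (gt_mem_nhds (by positivity))
  filter_upwards [h1] with k hk x hx
  have hx' := Metric.mem_closedBall.1 hx
  rw [dist_comm]
  refine lt_of_le_of_lt (b := ε / 2) ?_ (by linarith)
  apply ContDiffBump.dist_normed_convolution_le D.gm
  intro y hy
  have hy' := Metric.mem_ball.1 hy
  refine (hr2 y ?_ x ?_ (hy'.trans (hk.trans_le (min_le_left _ _)))).le
  · rw [Metric.mem_closedBall]
    have := dist_triangle y x x₀
    have := hk.trans_le (min_le_right _ _)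
    linarith
  · rw [Metric.mem_closedBall]; linarith

/-- the curl of a weak gradient vanishes -/
lemma Data.curl (D : Data x₀ R g A) (ζ : E2 → ℝ) (h1 : ContDiff ℝ (⊤ : ℕ∞) ζ)
    (h2 : HasCompactSupport ζ) (h3 : tsupport ζ ⊆ Metric.ball x₀ (2 * R)) :
    (∫ x, fderiv ℝ ζ x (e 1) • A x (e 0)) = ∫ x, fderiv ℝ ζ x (e 0) • A x (e 1) := by
  have hd : ∀ i, ContDiff ℝ (⊤ : ℕ∞) (fun x => fderiv ℝ ζ x (e i)) := fun i =>
    (h1.fderiv_right (m := (⊤ : ℕ∞)) (by norm_cast)).clm_apply contDiff_const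
  have hs : ∀ i, tsupport (fun x => fderiv ℝ ζ x (e i)) ⊆ tsupport ζ := fun i =>
    (closure_mono (by
      intro x hx
      simp only [Function.mem_support] at hx ⊢
      intro h0
      apply hx
      rw [h0]; simp)).trans (tsupport_fderiv_subset ℝ (f := ζ))
  have hc : ∀ i, HasCompactSupport (fun x => fderiv ℝ ζ x (e i)) := fun i =>
    h2.of_isClosed_subset (isClosed_tsupport _) (hs i)
  have w0 := D.weak _ (hd 1) (hc 1) ((hs 1).trans h3) 0
  have w1 := D.weak _ (hd 0) (hc 0) ((hs 0).trans h3) 1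
  have hsymm : ∀ x, fderiv ℝ (fun x => fderiv ℝ ζ x (e 1)) x (e 0) =
      fderiv ℝ (fun x => fderiv ℝ ζ x (e 0)) x (e 1) := by
    intro x
    have hdd : DifferentiableAt ℝ (fderiv ℝ ζ) x :=
      (h1.fderiv_right (m := (⊤ : ℕ∞)) (by norm_cast)).differentiable (by simp) x
    rw [fderiv_clm_apply hdd (differentiableAt_const _),
      fderiv_clm_apply hdd (differentiableAt_const _)]
    have := (h1.contDiffAt (x := x)).isSymmSndFDerivAt (by simp; norm_cast)
    simpa using this (e 0) (e 1)
  simp only [hsymm] at w0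
  rw [w0] at w1
  exact neg_inj.1 w1

end CF

namespace CF

open ContinuousLinearMap Filter
open scoped Convolution

lemma aesm_apply {F G : Type*} [NormedAddCommGroup F] [NormedSpace ℝ F] [NormedAddCommGroup G]
    [NormedSpace ℝ G] {S : E2 → F →L[ℝ] G} {v : E2 → F} {μ : Measure E2}
    (hS : AEStronglyMeasurable S μ) (hv : AEStronglyMeasurable v μ) :
    AEStronglyMeasurable (fun x => S x (v x)) μ :=
  (isBoundedBilinearMap_apply (𝕜 := ℝ) (E := F) (F := G)).continuous.comp_aestronglyMeasurable
    (hS.prodMk hv)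

lemma norm_apply_e_le (T : M2) (i : Fin 2) : ‖T (e i)‖ ≤ ‖T‖ := by
  have := T.le_opNorm (e i)
  simpa using this

variable {x₀ : E2} {R : ℝ} {g : E2 → E2} {A : E2 → M2}

lemma Data.mollA_memLp (D : Data x₀ R g A) (φ : ContDiffBump (0 : E2)) :
    MemLp (moll φ A) 2 volume :=
  ⟨(D.mollA_cont φ).aestronglyMeasurable, (moll_contr φ A D.Am).trans_lt D.A2.2⟩

def PP (η Γ : E2 → ℝ) (A : E2 → M2) (i j : Fin 2) (h : E2 → E2) (B : E2 → M2) (x : E2) : E2 :=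
  (Γ (h x) * fderiv ℝ η x (e i) + η x * fderiv ℝ Γ (h x) (B x (e i))) • A x (e j)

lemma Data.bounds {η Γ : E2 → ℝ}
    (h1 : ContDiff ℝ (⊤ : ℕ∞) η) (h2 : HasCompactSupport η)
    (hΓ : ContDiff ℝ (⊤ : ℕ∞) Γ) : ∃ C : ℝ, 0 ≤ C ∧ (∀ x, ‖η x‖ ≤ C) ∧
      (∀ y : E2, ‖y‖ ≤ 1 → ‖Γ y‖ ≤ C) ∧ (∀ y : E2, ‖y‖ ≤ 1 → ‖fderiv ℝ Γ y‖ ≤ C) := by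
  obtain ⟨C1, hC1⟩ := h2.exists_bound_of_continuous h1.continuous
  obtain ⟨C2, hC2⟩ := (isCompact_closedBall (0 : E2) 1).exists_bound_of_continuousOn
    hΓ.continuous.continuousOn
  obtain ⟨C3, hC3⟩ := (isCompact_closedBall (0 : E2) 1).exists_bound_of_continuousOn
    (hΓ.continuous_fderiv (by simp)).continuousOn
  refine ⟨max 0 (max C1 (max C2 C3)), le_max_left _ _, ?_, ?_, ?_⟩
  · intro x; exact (hC1 x).trans (by simp)
  · intro y hy; exact (hC2 y (by simpa using hy)).trans (by simp)
  · intro y hy; exact (hC3 y (by simpa using hy)).trans (by simp)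

lemma Data.PP_aesm (D : Data x₀ R g A) {η Γ : E2 → ℝ}
    (h1 : ContDiff ℝ (⊤ : ℕ∞) η) (hΓ : ContDiff ℝ (⊤ : ℕ∞) Γ) (i j : Fin 2) {h : E2 → E2}
    {B : E2 → M2} (hh : AEStronglyMeasurable h volume) (hB : AEStronglyMeasurable B volume) :
    AEStronglyMeasurable (PP η Γ A i j h B) volume := by
  unfold PP
  have a1 := hΓ.continuous.comp_aestronglyMeasurable hh
  have a2 := (hΓ.continuous_fderiv (by simp)).comp_aestronglyMeasurable hh
  have a3 := (h1.continuous_fderiv (by simp)).aestronglyMeasurable (μ := (volume : Measure E2))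
  have a4 := h1.continuous.aestronglyMeasurable (μ := (volume : Measure E2))
  have a5 : AEStronglyMeasurable (fun _ : E2 => e i) volume := aestronglyMeasurable_const
  have a6 : AEStronglyMeasurable (fun _ : E2 => e j) volume := aestronglyMeasurable_const
  exact ((a1.mul (aesm_apply a3 a5)).add (a4.mul (aesm_apply a2 (aesm_apply hB a5)))).smul
    (aesm_apply D.A2.1 a6)

lemma Data.PP_bound {η Γ : E2 → ℝ} {C : ℝ} (hC : 0 ≤ C)
    (hη : ∀ x, ‖η x‖ ≤ C) (hΓ1 : ∀ y : E2, ‖y‖ ≤ 1 → ‖Γ y‖ ≤ C)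
    (hΓ2 : ∀ y : E2, ‖y‖ ≤ 1 → ‖fderiv ℝ Γ y‖ ≤ C) (i j : Fin 2) {h : E2 → E2}
    {B : E2 → M2} (hh : ∀ x, ‖h x‖ ≤ 1) (x : E2) :
    ‖PP η Γ A i j h B x‖ ≤ C * (‖fderiv ℝ η x‖ * ‖A x‖) + C * C * (‖B x‖ * ‖A x‖) := by
  unfold PP
  rw [norm_smul]
  have b1 : ‖fderiv ℝ η x (e i)‖ ≤ ‖fderiv ℝ η x‖ := by
    simpa using (fderiv ℝ η x).le_opNorm (e i)
  have b2 : ‖fderiv ℝ Γ (h x) (B x (e i))‖ ≤ C * ‖B x‖ :=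
    ((fderiv ℝ Γ (h x)).le_opNorm _).trans
      (mul_le_mul (hΓ2 _ (hh x)) (norm_apply_e_le _ _) (norm_nonneg _) hC)
  calc _ ≤ (C * ‖fderiv ℝ η x‖ + C * (C * ‖B x‖)) * ‖A x‖ := by
        refine mul_le_mul ?_ (norm_apply_e_le _ _) (norm_nonneg _) (by positivity)
        refine (norm_add_le _ _).trans ?_
        rw [norm_mul, norm_mul]
        gcongr
        · exact hΓ1 _ (hh x)
        · exact hη x
    _ = _ := by ring

lemma Data.PP_bound_int (D : Data x₀ R g A) {η : E2 → ℝ}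
    (h1 : ContDiff ℝ (⊤ : ℕ∞) η) (h2 : HasCompactSupport η)
    {B : E2 → M2} (hB : MemLp B 2 volume) (C : ℝ) :
    Integrable (fun x => C * (‖fderiv ℝ η x‖ * ‖A x‖) + C * C * (‖B x‖ * ‖A x‖)) volume := by
  have a : MemLp (fderiv ℝ η) 2 volume :=
    (h1.continuous_fderiv (by simp)).memLp_of_hasCompactSupport (h2.fderiv ℝ)
  exact ((a.norm.integrable_mul D.A2.norm).const_mul C).add
    ((hB.norm.integrable_mul D.A2.norm).const_mul (C * C))

lemma Data.PP_tendsto (D : Data x₀ R g A) {φ : ℕ → ContDiffBump (0 : E2)}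
    (hφ : Tendsto (fun k => (φ k).rOut) atTop (𝓝 0)) {η Γ : E2 → ℝ}
    (h1 : ContDiff ℝ (⊤ : ℕ∞) η) (h2 : HasCompactSupport η)
    (h3 : tsupport η ⊆ Metric.ball x₀ R) (hΓ : ContDiff ℝ (⊤ : ℕ∞) Γ) (i j : Fin 2) :
    Tendsto (fun k => ∫ x, PP η Γ A i j (moll (φ k) g) (moll (φ k) A) x) atTop
      (𝓝 (∫ x, PP η Γ A i j g A x)) := by
  obtain ⟨C, hC, c1, c2, c3⟩ := Data.bounds h1 h2 hΓ
  have gkm : ∀ k, AEStronglyMeasurable (moll (φ k) g) volume := fun k =>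
    (D.moll_contDiff (φ k)).continuous.aestronglyMeasurable
  have t1 : Tendsto (fun k => ∫ x, PP η Γ A i j (moll (φ k) g) A x) atTop
      (𝓝 (∫ x, PP η Γ A i j g A x)) := by
    refine tendsto_integral_of_dominated_convergence _
      (fun k => D.PP_aesm h1 hΓ i j (gkm k) D.A2.1) (D.PP_bound_int h1 h2 D.A2 C) ?_ ?_
    · intro k
      exact Eventually.of_forall (Data.PP_bound hC c1 c2 c3 i j (D.moll_le (φ k)))
    · refine Eventually.of_forall fun x => ?_
      by_cases hx : x ∈ Metric.closedBall x₀ R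
      · have hg := (D.moll_unif hφ).tendsto_at hx
        have q1 := (hΓ.continuous.tendsto (g x)).comp hg
        have q2 := ((hΓ.continuous_fderiv (by simp)).tendsto (g x)).comp hg
        have q3 : Tendsto (fun k => fderiv ℝ Γ (moll (φ k) g x) (A x (e i))) atTop
            (𝓝 (fderiv ℝ Γ (g x) (A x (e i)))) :=
          ((ContinuousLinearMap.apply ℝ ℝ (A x (e i))).continuous.tendsto _).comp q2
        unfold PP
        exact ((q1.mul_const _).add ((q3.const_mul _))).smul_const _
      · have hx' : x ∉ tsupport η := fun h => hx (Metric.ball_subset_closedBall (h3 h))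
        have z1 : η x = 0 := image_eq_zero_of_notMem_tsupport hx'
        have z2 : fderiv ℝ η x = 0 :=
          image_eq_zero_of_notMem_tsupport (fun h => hx' (tsupport_fderiv_subset ℝ h))
        simp [PP, z1, z2]
  have t2 : Tendsto (fun k => ∫ x, (PP η Γ A i j (moll (φ k) g) (moll (φ k) A) x -
      PP η Γ A i j (moll (φ k) g) A x)) atTop (𝓝 0) := by
    have u := moll_pair hφ A D.Am D.A2 A D.A2
    have u2 : Tendsto (fun k => ENNReal.ofReal (C * C) *
        ∫⁻ x, ‖moll (φ k) A x - A x‖ₑ * ‖A x‖ₑ) atTop (𝓝 0) := by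
      have := ENNReal.Tendsto.const_mul (a := ENNReal.ofReal (C * C)) u (Or.inr (by simp))
      simpa using this
    rw [tendsto_zero_iff_enorm_tendsto_zero]
    refine tendsto_of_tendsto_of_tendsto_of_le_of_le tendsto_const_nhds u2 (fun _ => zero_le) ?_
    intro k
    beta_reduce
    refine (enorm_integral_le_lintegral_enorm _).trans ?_
    rw [← lintegral_const_mul' _ _ (by simp)]
    apply lintegral_mono
    intro x
    have eq : PP η Γ A i j (moll (φ k) g) (moll (φ k) A) x - PP η Γ A i j (moll (φ k) g) A x =
      (η x * fderiv ℝ Γ (moll (φ k) g x) ((moll (φ k) A x - A x) (e i))) • A x (e j) := by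
      unfold PP
      rw [← sub_smul]
      congr 1
      simp only [sub_apply, map_sub]
      ring
    beta_reduce
    rw [eq]
    have nb : ‖(η x * fderiv ℝ Γ (moll (φ k) g x) ((moll (φ k) A x - A x) (e i))) • A x (e j)‖ ≤
        (C * C) * (‖moll (φ k) A x - A x‖ * ‖A x‖) := by
      rw [norm_smul, norm_mul]
      calc _ ≤ (C * (C * ‖moll (φ k) A x - A x‖)) * ‖A x‖ := by
            gcongr
            · exact c1 x
            · exact ((fderiv ℝ Γ _).le_opNorm _).trans
                (mul_le_mul (c3 _ (D.moll_le (φ k) x)) (norm_apply_e_le _ _) (norm_nonneg _) hC)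
            · exact norm_apply_e_le _ _
        _ = _ := by ring
    rw [← ofReal_norm, ← ofReal_norm, ← ofReal_norm,
      ← ENNReal.ofReal_mul (norm_nonneg _), ← ENNReal.ofReal_mul (by positivity)]
    exact ENNReal.ofReal_le_ofReal nb
  have t3 := t2.add t1
  rw [zero_add] at t3
  refine t3.congr fun k => ?_
  have I1 : Integrable (PP η Γ A i j (moll (φ k) g) (moll (φ k) A)) volume :=
    (D.PP_bound_int h1 h2 (D.mollA_memLp (φ k)) C).mono'
      (D.PP_aesm h1 hΓ i j (gkm k) (D.mollA_memLp (φ k)).1)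
      (Eventually.of_forall (Data.PP_bound hC c1 c2 c3 i j (D.moll_le (φ k))))
  have I2 : Integrable (PP η Γ A i j (moll (φ k) g) A) volume :=
    (D.PP_bound_int h1 h2 D.A2 C).mono'
      (D.PP_aesm h1 hΓ i j (gkm k) D.A2.1)
      (Eventually.of_forall (Data.PP_bound hC c1 c2 c3 i j (D.moll_le (φ k))))
  rw [integral_sub I1 I2]; abel

lemma Data.PP_integrable (D : Data x₀ R g A) {η Γ : E2 → ℝ}
    (h1 : ContDiff ℝ (⊤ : ℕ∞) η) (h2 : HasCompactSupport η)
    (hΓ : ContDiff ℝ (⊤ : ℕ∞) Γ) (i j : Fin 2) :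
    Integrable (PP η Γ A i j g A) volume := by
  obtain ⟨C, hC, c1, c2, c3⟩ := Data.bounds h1 h2 hΓ
  exact (D.PP_bound_int h1 h2 D.A2 C).mono'
      (D.PP_aesm h1 hΓ i j D.gm D.A2.1)
      (Eventually.of_forall (Data.PP_bound hC c1 c2 c3 i j D.g1))

/-- a sequence of bumps with radii tending to zero -/
def bump (k : ℕ) : ContDiffBump (0 : E2) where
  rIn := 1 / (k + 1 : ℝ) / 2
  rOut := 1 / (k + 1 : ℝ)
  rIn_pos := by positivity
  rIn_lt_rOut := half_lt_self (by positivity)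

lemma bump_tendsto : Tendsto (fun k => (bump k).rOut) atTop (𝓝 0) :=
  tendsto_one_div_add_atTop_nhds_zero_nat

lemma Data.PP_eq (D : Data x₀ R g A) {η Γ : E2 → ℝ}
    (h1 : ContDiff ℝ (⊤ : ℕ∞) η) (h2 : HasCompactSupport η)
    (h3 : tsupport η ⊆ Metric.ball x₀ R) (hΓ : ContDiff ℝ (⊤ : ℕ∞) Γ) :
    (∫ x, PP η Γ A 1 0 g A x) = ∫ x, PP η Γ A 0 1 g A x := by
  refine tendsto_nhds_unique_of_eventuallyEq (D.PP_tendsto bump_tendsto h1 h2 h3 hΓ 1 0)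
    (D.PP_tendsto bump_tendsto h1 h2 h3 hΓ 0 1) ?_
  filter_upwards [bump_tendsto.eventually (gt_mem_nhds D.hR)] with k hk
  set ζ : E2 → ℝ := fun x => η x * Γ (moll (bump k) g x) with hζ
  have z1 : ContDiff ℝ (⊤ : ℕ∞) ζ := h1.mul (hΓ.comp (D.moll_contDiff (bump k)))
  have zs : tsupport ζ ⊆ tsupport η := tsupport_mul_subset_left
  have z2 : HasCompactSupport ζ := h2.mul_right
  have hR := D.hR
  have hc := D.curl ζ z1 z2 (zs.trans (h3.trans (Metric.ball_subset_ball (by linarith))))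
  have hd : ∀ i j x, fderiv ℝ ζ x (e i) • A x (e j) =
      PP η Γ A i j (moll (bump k) g) (moll (bump k) A) x := by
    intro i j x
    by_cases hx : x ∈ tsupport η
    · have d1 := D.moll_hasFDerivAt (bump k) hk (Metric.ball_subset_closedBall (h3 hx))
      have d2 := ((hΓ.differentiable (by simp)) (moll (bump k) g x)).hasFDerivAt.comp x d1
      have d3 : HasFDerivAt ζ _ x := ((h1.differentiable (by simp)) x).hasFDerivAt.mul d2
      rw [d3.fderiv]
      unfold PP
      congr 1
      simp
      ring
    · have y1 : η x = 0 := image_eq_zero_of_notMem_tsupport hx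
      have y2 : fderiv ℝ η x = 0 :=
          image_eq_zero_of_notMem_tsupport (fun h => hx (tsupport_fderiv_subset ℝ h))
      have y3 : fderiv ℝ ζ x = 0 :=
          image_eq_zero_of_notMem_tsupport (fun h => hx (zs (tsupport_fderiv_subset ℝ h)))
      simp [PP, y1, y2, y3]
  simpa only [hd] using hc

end CF

namespace CF

open ContinuousLinearMap Filter

lemma det2 (T : M2) : T.det = (T (e 0)) 0 * (T (e 1)) 1 - (T (e 1)) 0 * (T (e 0)) 1 := by
  have : T.det = LinearMap.det (T : E2 →ₗ[ℝ] E2) := rfl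
  rw [this, ← LinearMap.det_toMatrix (EuclideanSpace.basisFun (Fin 2) ℝ).toBasis,
    Matrix.det_fin_two]
  simp [LinearMap.toMatrix_apply]

lemma decomp2 (v : E2) : v = v 0 • e 0 + v 1 • e 1 := by
  ext i; fin_cases i <;> simp

lemma comp_le (v : E2) (i : Fin 2) : |v i| ≤ ‖v‖ := by
  simpa using PiLp.norm_apply_le v i

variable {x₀ : E2} {R : ℝ} {g : E2 → E2} {A : E2 → M2}

def Gc (ε : ℝ) (i : Fin 2) (y : E2) : ℝ := GG ε y i

lemma Gc_contDiff {ε : ℝ} (hε : 0 < ε) (i : Fin 2) : ContDiff ℝ (⊤ : ℕ∞) (Gc ε i) :=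
  (EuclideanSpace.proj (𝕜 := ℝ) i).contDiff.comp (GG_contDiff hε)

lemma Gc_fderiv {ε : ℝ} (hε : 0 < ε) (i : Fin 2) (y v : E2) :
    fderiv ℝ (Gc ε i) y v = (fderiv ℝ (GG ε) y v) i := by
  have h1 := ((GG_contDiff hε).differentiable (by simp) y).hasFDerivAt
  have h2 : HasFDerivAt (Gc ε i) _ y :=
    (EuclideanSpace.proj (𝕜 := ℝ) i).hasFDerivAt.comp y h1
  rw [h2.fderiv]; simp

def ZZ (η : E2 → ℝ) (ε : ℝ) (A : E2 → M2) (g : E2 → E2) (x : E2) : ℝ :=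
  ((PP η (Gc ε 0) A 0 1 g A x) 1 - (PP η (Gc ε 0) A 1 0 g A x) 1) +
  ((PP η (Gc ε 1) A 1 0 g A x) 0 - (PP η (Gc ε 1) A 0 1 g A x) 0)

lemma int_comp {F : E2 → E2} (hF : Integrable F volume) (i : Fin 2) :
    Integrable (fun x => F x i) volume ∧ ∫ x, F x i = (∫ x, F x) i :=
  ⟨(EuclideanSpace.proj (𝕜 := ℝ) i).integrable_comp hF,
    (EuclideanSpace.proj (𝕜 := ℝ) i).integral_comp_comm hF⟩

lemma int4 {a b c d : E2 → ℝ} (ha : Integrable a volume) (hb : Integrable b volume)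
    (hc : Integrable c volume) (hd : Integrable d volume) :
    Integrable (fun x => (a x - b x) + (c x - d x)) volume ∧
    ∫ x, ((a x - b x) + (c x - d x)) =
      ((∫ x, a x) - (∫ x, b x)) + ((∫ x, c x) - (∫ x, d x)) := by
  have h1 : Integrable (fun x => a x - b x) volume := ha.sub hb
  have h2 : Integrable (fun x => c x - d x) volume := hc.sub hd
  refine ⟨h1.add h2, ?_⟩
  rw [integral_add h1 h2, integral_sub ha hb, integral_sub hc hd]

lemma Data.ZZ_int (D : Data x₀ R g A) {η : E2 → ℝ} {ε : ℝ} (hε : 0 < ε)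
    (h1 : ContDiff ℝ (⊤ : ℕ∞) η) (h2 : HasCompactSupport η)
    (h3 : tsupport η ⊆ Metric.ball x₀ R) :
    Integrable (ZZ η ε A g) volume ∧ ∫ x, ZZ η ε A g x = 0 := by
  have I := fun k i j => D.PP_integrable h1 h2 (Gc_contDiff hε k) i j
  have a1 := int_comp (I 0 0 1) 1
  have a2 := int_comp (I 0 1 0) 1
  have a3 := int_comp (I 1 1 0) 0
  have a4 := int_comp (I 1 0 1) 0
  have a5 := int4 a1.1 a2.1 a3.1 a4.1
  refine ⟨a5.1, ?_⟩
  unfold ZZ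
  rw [a5.2, a1.2, a2.2, a3.2, a4.2,
    D.PP_eq h1 h2 h3 (Gc_contDiff hε 0), D.PP_eq h1 h2 h3 (Gc_contDiff hε 1)]
  ring

lemma ZZ_ge {η : E2 → ℝ} {ε : ℝ} (hε : 0 < ε) (x : E2) :
    η x * (A x).det * divG ε (g x) - 4 * (‖fderiv ℝ η x‖ * ‖A x‖ * ‖GG ε (g x)‖) ≤
      ZZ η ε A g x := by
  set y := g x
  set T := A x
  have key : ZZ η ε A g x = η x * T.det * divG ε y +
      (GG ε y 0 * fderiv ℝ η x (e 0) * (T (e 1)) 1 - GG ε y 0 * fderiv ℝ η x (e 1) * (T (e 0)) 1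
      + GG ε y 1 * fderiv ℝ η x (e 1) * (T (e 0)) 0
      - GG ε y 1 * fderiv ℝ η x (e 0) * (T (e 1)) 0) := by
    have hd : ∀ v : E2, fderiv ℝ (GG ε) (g x) v =
        v 0 • fderiv ℝ (GG ε) (g x) (e 0) + v 1 • fderiv ℝ (GG ε) (g x) (e 1) := by
      intro v
      conv_lhs => rw [decomp2 v]
      rw [map_add, map_smul, map_smul]
    simp only [y, T]
    rw [det2]
    simp only [ZZ, PP, Gc_fderiv hε]
    simp only [hd (A x (e 0)), hd (A x (e 1)), divG, Gc]
    simp only [PiLp.add_apply, PiLp.smul_apply, smul_eq_mul]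
    ring
  rw [key]
  have b : ∀ i j k l, |GG ε y i * fderiv ℝ η x (e j) * (T (e k)) l| ≤
      ‖fderiv ℝ η x‖ * ‖T‖ * ‖GG ε y‖ := by
    intro i j k l
    rw [abs_mul, abs_mul]
    have c1 := comp_le (GG ε y) i
    have c2 : |fderiv ℝ η x (e j)| ≤ ‖fderiv ℝ η x‖ := by
      simpa using (fderiv ℝ η x).le_opNorm (e j)
    have c3 := (comp_le (T (e k)) l).trans (norm_apply_e_le T k)
    calc _ ≤ ‖GG ε y‖ * ‖fderiv ℝ η x‖ * ‖T‖ := by gcongr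
      _ = _ := by ring
  have b1 := abs_le.1 (b 0 0 1 1)
  have b2 := abs_le.1 (b 0 1 0 1)
  have b3 := abs_le.1 (b 1 1 0 0)
  have b4 := abs_le.1 (b 1 0 1 0)
  linarith [b1.1, b2.2, b3.1, b4.2]

lemma le_of_sq_bound {a X c K q : ℝ} (hX : 0 ≤ X) (hK : 0 ≤ K) (hc : 0 ≤ c)
    (h : a ^ 2 ≤ q * (K * X)) (hq : q ≤ 2 * c) : a ≤ X / 2 + c * K := by
  apply abs_le_of_sq_le_sq' _ (by positivity) |>.2
  have : q * (K * X) ≤ 2 * c * (K * X) := by gcongr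
  nlinarith [sq_nonneg (X / 2 - c * K)]

lemma Data.cacc (D : Data x₀ R g A) (K : E2 → ℝ) (hK1 : ∀ x, 1 ≤ K x)
    (hK : IntegrableOn K (Metric.closedBall x₀ R) volume)
    (hdist : ∀ᵐ x ∂(volume.restrict (Metric.closedBall x₀ R)),
      ‖A x‖ ^ 2 ≤ K x * (A x).det) :
    ∃ C : ℝ, 0 ≤ C ∧ ∀ ε : ℝ, 0 < ε → ε ≤ 1 →
      ∫⁻ x in Metric.ball x₀ (R / 2), ENNReal.ofReal (‖A x‖ * ‖GG ε (g x)‖) ≤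
        ENNReal.ofReal C := by
  have hR := D.hR
  let φ : ContDiffBump x₀ := ⟨R / 2, 3 * R / 4, by positivity, by linarith⟩
  have hφc : ContDiff ℝ (⊤ : ℕ∞) φ := φ.contDiff
  obtain ⟨M, hM⟩ := (φ.hasCompactSupport.fderiv ℝ).exists_bound_of_continuous
    (hφc.continuous_fderiv (by simp))
  have hM0 : 0 ≤ M := (norm_nonneg _).trans (hM x₀)
  set η : E2 → ℝ := fun x => φ x ^ 2 with hη
  have h1 : ContDiff ℝ (⊤ : ℕ∞) η := hφc.pow 2
  have hts : tsupport η ⊆ tsupport φ := by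
    apply closure_mono
    intro x hx hx0
    apply hx
    simp [hη, hx0]
  have h2 : HasCompactSupport η := φ.hasCompactSupport.of_isClosed_subset (isClosed_tsupport _) hts
  have h3 : tsupport η ⊆ Metric.ball x₀ R := by
    refine hts.trans ?_
    rw [φ.tsupport_eq]
    apply Metric.closedBall_subset_ball
    change 3 * R / 4 < R
    linarith
  have hηd : ∀ x, ‖fderiv ℝ η x‖ ≤ 2 * φ x * M := by
    intro x
    have d : HasFDerivAt η _ x := ((hφc.differentiable (by simp)) x).hasFDerivAt.pow 2
    rw [d.fderiv, norm_smul]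
    have := hM x
    have p : 0 ≤ φ x := φ.nonneg
    simp only [Nat.add_one_sub_one, pow_one]
    rw [Real.norm_of_nonneg (by positivity)]
    norm_num
    gcongr
  set c : ℝ := 48 * M ^ 2 + 3 / 4 with hc
  have hc0 : 0 ≤ c := by positivity
  refine ⟨c * ∫ x in Metric.closedBall x₀ R, K x, ?_, ?_⟩
  · apply mul_nonneg hc0
    exact integral_nonneg fun x => zero_le_one.trans (hK1 x)
  intro ε hε hε1
  obtain ⟨zi, z0⟩ := D.ZZ_int hε h1 h2 h3
  have hae : ∀ᵐ x ∂(volume.restrict (Metric.closedBall x₀ R)),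
      φ x * ‖A x‖ * ‖GG ε (g x)‖ ≤ ZZ η ε A g x + c * K x := by
    filter_upwards [hdist] with x hx
    have hKx := hK1 x
    have hJ : 0 ≤ (A x).det := by
      by_contra hneg
      push Not at hneg
      nlinarith [sq_nonneg ‖A x‖]
    have hdiv := divG_ge hε hε1 (g x) (D.g1 x)
    have hp : 0 ≤ divG ε (g x) := by nlinarith [sq_nonneg ‖GG ε (g x)‖]
    have hφ0 : 0 ≤ φ x := φ.nonneg
    set X := η x * (A x).det * divG ε (g x) with hX
    have hX0 : 0 ≤ X := by
      apply mul_nonneg (mul_nonneg (by positivity) hJ) hp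
    have hz := ZZ_ge (η := η) (A := A) (g := g) hε x
    have sq1 : (φ x * ‖A x‖ * ‖GG ε (g x)‖) ^ 2 ≤ 3 / 2 * (K x * X) := by
      calc (φ x * ‖A x‖ * ‖GG ε (g x)‖) ^ 2 = φ x ^ 2 * (‖A x‖ ^ 2 * ‖GG ε (g x)‖ ^ 2) := by ring
        _ ≤ φ x ^ 2 * ((K x * (A x).det) * (3 / 2 * divG ε (g x))) := by
          gcongr
          linarith
        _ = _ := by rw [hX, hη]; ring
    have i1 := le_of_sq_bound (c := 3 / 4) hX0 (by linarith) (by norm_num) sq1 (by norm_num)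
    have sq2 : (8 * M * (φ x * ‖A x‖ * ‖GG ε (g x)‖)) ^ 2 ≤ 96 * M ^ 2 * (K x * X) := by
      rw [mul_pow]
      nlinarith [mul_le_mul_of_nonneg_left sq1 (sq_nonneg (8 * M))]
    have i2 := le_of_sq_bound (c := 48 * M ^ 2) hX0 (by linarith : 0 ≤ K x) (by positivity) sq2
      (by linarith)
    have i3 : 4 * (‖fderiv ℝ η x‖ * ‖A x‖ * ‖GG ε (g x)‖) ≤
        8 * M * (φ x * ‖A x‖ * ‖GG ε (g x)‖) := by
      calc _ ≤ 4 * ((2 * φ x * M) * ‖A x‖ * ‖GG ε (g x)‖) := by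
            gcongr; exact hηd x
        _ = _ := by ring
    rw [hc]
    linarith
  have zB : ∫ x in Metric.closedBall x₀ R, ZZ η ε A g x = 0 := by
    rw [setIntegral_eq_integral_of_forall_compl_eq_zero, z0]
    intro x hx
    have hx' : x ∉ tsupport η := fun h => hx (Metric.ball_subset_closedBall (h3 h))
    have y1 : η x = 0 := image_eq_zero_of_notMem_tsupport hx'
    have y2 : fderiv ℝ η x = 0 :=
      image_eq_zero_of_notMem_tsupport (fun h => hx' (tsupport_fderiv_subset ℝ h))
    simp [ZZ, PP, y1, y2]
  have wi : IntegrableOn (fun x => ZZ η ε A g x + c * K x) (Metric.closedBall x₀ R) volume :=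
    zi.integrableOn.add (hK.const_mul c)
  have wI : ∫ x in Metric.closedBall x₀ R, (ZZ η ε A g x + c * K x) =
      c * ∫ x in Metric.closedBall x₀ R, K x := by
    rw [integral_add zi.integrableOn (hK.const_mul c), zB, zero_add, integral_const_mul]
  have hpos : ∀ᵐ x ∂(volume.restrict (Metric.closedBall x₀ R)),
      0 ≤ ZZ η ε A g x + c * K x := by
    filter_upwards [hae] with x hx
    have p : 0 ≤ φ x := φ.nonneg
    exact le_trans (by positivity) hx
  rw [← wI, ofReal_integral_eq_lintegral_ofReal wi hpos]
  calc _ = ∫⁻ x in Metric.ball x₀ (R / 2),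
        ENNReal.ofReal (φ x * ‖A x‖ * ‖GG ε (g x)‖) := by
        apply setLIntegral_congr_fun Metric.isOpen_ball.measurableSet
        intro x hx
        have : φ x = 1 := φ.one_of_mem_closedBall (Metric.ball_subset_closedBall hx)
        simp [this]
    _ ≤ ∫⁻ x in Metric.closedBall x₀ R, ENNReal.ofReal (φ x * ‖A x‖ * ‖GG ε (g x)‖) :=
        lintegral_mono_set ((Metric.ball_subset_ball (by linarith)).trans
          Metric.ball_subset_closedBall)
    _ ≤ _ := by
        apply lintegral_mono_ae
        filter_upwards [hae] with x hx
        exact ENNReal.ofReal_le_ofReal hx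

end CF

namespace CF
open Filter

lemma circlePt_zero_coord (t θ : ℝ) : circlePt t θ 0 = t * Real.cos θ := by simp [circlePt]
lemma circlePt_one_coord (t θ : ℝ) : circlePt t θ 1 = t * Real.sin θ := by simp [circlePt]

lemma circlePt_norm {t : ℝ} (ht : 0 ≤ t) (θ : ℝ) : ‖circlePt t θ‖ = t := by
  have h : ‖circlePt t θ‖ ^ 2 = t ^ 2 := by
    rw [EuclideanSpace.norm_sq_eq, Fin.sum_univ_two, circlePt_zero_coord, circlePt_one_coord]
    simp only [Real.norm_eq_abs, sq_abs]
    nlinarith [Real.sin_sq_add_cos_sq θ]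
  exact (sq_eq_sq₀ (norm_nonneg _) ht).1 h

lemma circlePt_hasDerivAt (t θ : ℝ) :
    HasDerivAt (fun θ => circlePt t θ) (circlePt t (θ + π / 2)) θ := by
  have h : HasDerivAt (fun θ => (![t * Real.cos θ, t * Real.sin θ] : Fin 2 → ℝ))
      ![t * Real.cos (θ + π / 2), t * Real.sin (θ + π / 2)] θ := by
    rw [hasDerivAt_pi]
    intro i
    fin_cases i
    · simpa [Real.cos_add_pi_div_two] using (Real.hasDerivAt_cos θ).const_mul t
    · simpa [Real.sin_add_pi_div_two] using (Real.hasDerivAt_sin θ).const_mul t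
  exact ((EuclideanSpace.equiv (Fin 2) ℝ).symm.toContinuousLinearMap.hasFDerivAt).comp_hasDerivAt θ h

lemma circlePt_cont : Continuous (fun p : ℝ × ℝ => circlePt p.1 p.2) := by
  unfold circlePt
  apply (EuclideanSpace.equiv (Fin 2) ℝ).symm.continuous.comp
  apply continuous_pi
  intro i
  fin_cases i <;> simp <;> fun_prop

lemma exists_circlePt (v : E2) : ∃ θ ∈ Icc (-π) π, v = circlePt ‖v‖ θ := by
  set z : ℂ := ⟨v 0, v 1⟩ with hz
  have hn : ‖z‖ = ‖v‖ := by
    rw [Complex.norm_def, EuclideanSpace.norm_eq, Fin.sum_univ_two]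
    simp [Complex.normSq_apply, hz, sq]
  refine ⟨z.arg, ⟨(Complex.neg_pi_lt_arg z).le, Complex.arg_le_pi z⟩, ?_⟩
  ext i
  fin_cases i
  · show v 0 = circlePt _ _ 0
    rw [circlePt_zero_coord, ← hn, Complex.norm_mul_cos_arg]
  · show v 1 = circlePt _ _ 1
    rw [circlePt_one_coord, ← hn, Complex.norm_mul_sin_arg]

lemma polar_lint (x₀ : E2) (F : E2 → ℝ≥0∞) :
    ∫⁻ p in polarCoord.target, ENNReal.ofReal p.1 * F (x₀ + circlePt p.1 p.2) = ∫⁻ x, F x := by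
  rw [← lintegral_add_left_eq_self F x₀,
    ← (PiLp.volume_preserving_toLp (Fin 2)).lintegral_comp_emb
      (MeasurableEquiv.toLp 2 _).measurableEmbedding,
    ← (volume_preserving_finTwoArrow ℝ).symm.lintegral_comp_emb
      (MeasurableEquiv.finTwoArrow).symm.measurableEmbedding,
    ← lintegral_comp_polarCoord_symm]
  rfl

lemma polar_lower (x₀ : E2) (H : E2 → ℝ≥0∞) (hH : Measurable H) {t1 t2 r : ℝ} (h1 : 0 < t1)
    (h2 : t2 ≤ r) (c : ℝ≥0∞)
    (h : ∀ t ∈ Ioo t1 t2,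
      c ≤ ∫⁻ θ in Ioo (-π) π, ENNReal.ofReal t * H (x₀ + circlePt t θ)) :
    c * ENNReal.ofReal (t2 - t1) ≤ ∫⁻ x in Metric.ball x₀ r, H x := by
  have hm : Measurable (fun p : ℝ × ℝ => ENNReal.ofReal p.1 * H (x₀ + circlePt p.1 p.2)) := by
    apply Measurable.mul (by fun_prop)
    exact hH.comp (continuous_const.add circlePt_cont).measurable
  calc c * ENNReal.ofReal (t2 - t1) = ∫⁻ t in Ioo t1 t2, c := by simp
    _ ≤ ∫⁻ t in Ioo t1 t2, ∫⁻ θ in Ioo (-π) π, ENNReal.ofReal t * H (x₀ + circlePt t θ) :=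
        setLIntegral_mono' measurableSet_Ioo h
    _ = ∫⁻ p in Ioo t1 t2 ×ˢ Ioo (-π) π, ENNReal.ofReal p.1 * H (x₀ + circlePt p.1 p.2) := by
        rw [Measure.volume_eq_prod, ← Measure.prod_restrict, lintegral_prod _ hm.aemeasurable]
    _ = ∫⁻ p in Ioo t1 t2 ×ˢ Ioo (-π) π, ENNReal.ofReal p.1 *
          (Metric.ball x₀ r).indicator H (x₀ + circlePt p.1 p.2) := by
        apply setLIntegral_congr_fun (measurableSet_Ioo.prod measurableSet_Ioo)
        rintro ⟨t, θ⟩ ⟨ht, -⟩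
        have ht' : 0 ≤ t := (h1.trans ht.1).le
        have : x₀ + circlePt t θ ∈ Metric.ball x₀ r := by
          simp [circlePt_norm ht']
          exact lt_of_lt_of_le ht.2 h2
        simp only [indicator_of_mem this]
    _ ≤ ∫⁻ p in polarCoord.target, ENNReal.ofReal p.1 *
          (Metric.ball x₀ r).indicator H (x₀ + circlePt p.1 p.2) := by
        apply lintegral_mono_set
        rintro ⟨t, θ⟩ ⟨ht, hθ⟩
        exact ⟨h1.trans ht.1, hθ⟩
    _ = _ := by
        rw [polar_lint, lintegral_indicator Metric.isOpen_ball.measurableSet]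

lemma circle_osc {x₀ : E2} {R : ℝ} {g : E2 → E2} {A : E2 → M2} (D : Data x₀ R g A)
    (φ : ContDiffBump (0 : E2)) (hφ : φ.rOut < R) {ε : ℝ} (hε : 0 < ε) {t : ℝ} (ht : 0 < t)
    (htR : t ≤ R) {α β : ℝ} (hα : α ∈ Icc (-π) π) (hβ : β ∈ Icc (-π) π) :
    ENNReal.ofReal (VV ε (moll φ g (x₀ + circlePt t β)) - VV ε (moll φ g (x₀ + circlePt t α))) ≤
      ∫⁻ θ in Ioo (-π) π, ENNReal.ofReal t * ENNReal.ofReal (2 *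
        (‖moll φ A (x₀ + circlePt t θ)‖ * ‖GG ε (moll φ g (x₀ + circlePt t θ))‖)) := by
  set γ : ℝ → E2 := fun θ => x₀ + circlePt t θ with hγ
  have γc : Continuous γ := by
    have := circlePt_cont.comp (Continuous.prodMk_right t)
    exact continuous_const.add this
  have mem : ∀ θ, γ θ ∈ Metric.closedBall x₀ R := by
    intro θ
    simp [hγ, circlePt_norm ht.le, htR]
  set w : ℝ → ℝ := fun θ => VV ε (moll φ g (γ θ))
  set w' : ℝ → ℝ := fun θ => fderiv ℝ (VV ε) (moll φ g (γ θ)) (moll φ A (γ θ) (circlePt t (θ + π/2)))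
  have gcont : Continuous (moll φ g) := (D.moll_contDiff φ).continuous
  have Acont : Continuous (moll φ A) := D.mollA_cont φ
  have hw : ∀ θ, HasDerivAt w (w' θ) θ := by
    intro θ
    have h1 : HasDerivAt γ (circlePt t (θ + π / 2)) θ := (circlePt_hasDerivAt t θ).const_add x₀
    have h2 := (D.moll_hasFDerivAt φ hφ (mem θ)).comp_hasDerivAt θ h1
    have h3 : HasFDerivAt (VV ε) (fderiv ℝ (VV ε) (moll φ g (γ θ))) (moll φ g (γ θ)) :=
      ((VV_contDiff hε).differentiable (by simp) _).hasFDerivAt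
    exact h3.comp_hasDerivAt θ h2
  have w'c : Continuous w' := by
    have c1 : Continuous (fderiv ℝ (VV ε)) := (VV_contDiff hε).continuous_fderiv (by simp)
    have c2 : Continuous (fun θ => circlePt t (θ + π/2)) :=
      circlePt_cont.comp (continuous_const.prodMk (continuous_id.add continuous_const))
    exact (c1.comp (gcont.comp γc)).clm_apply ((Acont.comp γc).clm_apply c2)
  have hb : ∀ θ, ‖w' θ‖ ≤ t * (2 * (‖moll φ A (γ θ)‖ * ‖GG ε (moll φ g (γ θ))‖)) := by
    intro θ
    calc ‖w' θ‖ ≤ ‖fderiv ℝ (VV ε) (moll φ g (γ θ))‖ * (‖moll φ A (γ θ)‖ * t) := by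
          refine (ContinuousLinearMap.le_opNorm _ _).trans ?_
          gcongr
          refine (ContinuousLinearMap.le_opNorm _ _).trans ?_
          rw [circlePt_norm ht.le]
      _ ≤ (2 * ‖GG ε (moll φ g (γ θ))‖) * (‖moll φ A (γ θ)‖ * t) := by
          gcongr
          exact VV_fderiv_le hε _
      _ = _ := by ring
  have ftc : ∫ θ in α..β, w' θ = w β - w α :=
    intervalIntegral.integral_eq_sub_of_hasDerivAt (fun θ _ => hw θ) (w'c.intervalIntegrable _ _)
  have : ‖w β - w α‖ₑ ≤ ∫⁻ θ in Ioo (-π) π, ‖w' θ‖ₑ := by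
    rw [← ftc]
    have : ‖∫ θ in α..β, w' θ‖ₑ = ‖∫ θ in uIoc α β, w' θ‖ₑ := by
      rw [← ofReal_norm, ← ofReal_norm, intervalIntegral.norm_intervalIntegral_eq]
    rw [this]
    refine (enorm_integral_le_lintegral_enorm _).trans ?_
    rw [← Measure.restrict_congr_set (Ioo_ae_eq_Ioc (μ := volume) (a := -π) (b := π)).symm]
    apply lintegral_mono_set
    exact Ioc_subset_Ioc (le_min hα.1 hβ.1) (max_le hα.2 hβ.2)
  calc _ ≤ ‖w β - w α‖ₑ := by
        rw [← ofReal_norm]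
        exact ENNReal.ofReal_le_ofReal (le_abs_self _)
    _ ≤ _ := this
    _ ≤ _ := by
        apply lintegral_mono
        intro θ
        beta_reduce
        rw [← ENNReal.ofReal_mul ht.le, ← ofReal_norm]
        exact ENNReal.ofReal_le_ofReal (hb θ)

end CF

namespace CF
open Filter

variable {x₀ : E2} {R : ℝ} {g : E2 → E2} {A : E2 → M2}

lemma Data.comp_unif (D : Data x₀ R g A) {F : Type*} [NormedAddCommGroup F] (h : E2 → F)
    (hh : Continuous h) {δ : ℝ} (hδ : 0 < δ) :
    ∀ᶠ k in atTop, ∀ x ∈ Metric.closedBall x₀ R, dist (h (moll (bump k) g x)) (h (g x)) < δ := by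
  have huc := (isCompact_closedBall (0 : E2) 1).uniformContinuousOn_of_continuous hh.continuousOn
  rw [Metric.uniformContinuousOn_iff] at huc
  obtain ⟨η, hη, H⟩ := huc δ hδ
  have hu := D.moll_unif bump_tendsto
  rw [Metric.tendstoUniformlyOn_iff] at hu
  filter_upwards [hu η hη] with k hk x hx
  apply H
  · simpa using D.moll_le (bump k) x
  · simpa using D.g1 x
  · rw [dist_comm]; exact hk x hx

lemma Data.limit_bound (D : Data x₀ R g A) {ε : ℝ} (hε : 0 < ε) (C0 : ℝ≥0∞)
    (hC : ∫⁻ x in Metric.ball x₀ (R/2), ENNReal.ofReal (‖A x‖ * ‖GG ε (g x)‖) ≤ C0) :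
    ∀ᶠ k in atTop, ∫⁻ x in Metric.ball x₀ (R/2), ENNReal.ofReal
      (2 * (‖moll (bump k) A x‖ * ‖GG ε (moll (bump k) g x)‖)) ≤ 2 * (C0 + 2) := by
  have hGc : Continuous (GG ε) := (GG_contDiff hε).continuous
  obtain ⟨M, hM⟩ := (isCompact_closedBall (0 : E2) 1).exists_bound_of_continuousOn hGc.continuousOn
  have hR := D.hR
  have hM0 : 0 ≤ M := (norm_nonneg _).trans (hM 0 (by simp))
  set B := Metric.ball x₀ (R/2) with hB
  have hBm : MeasurableSet B := Metric.isOpen_ball.measurableSet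
  have hBf : volume B ≠ ⊤ := measure_ball_lt_top.ne
  set I := ∫⁻ x in B, ‖A x‖ₑ with hI
  have hIf : I ≠ ⊤ := by
    have h1 : LocallyIntegrable A volume := D.Ali
    have h2 : IntegrableOn A (Metric.closedBall x₀ R) volume :=
      h1.integrableOn_isCompact (isCompact_closedBall _ _)
    have h3 : IntegrableOn A B volume := h2.mono_set
      ((Metric.ball_subset_ball (by linarith)).trans Metric.ball_subset_closedBall)
    exact h3.2.ne
  set δ : ℝ := 1 / (I.toReal + 1) with hδ
  have hδ0 : 0 < δ := by positivity
  have hδI : ENNReal.ofReal δ * I ≤ 1 := by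
    rw [← ENNReal.ofReal_toReal hIf, ← ENNReal.ofReal_mul hδ0.le]
    rw [ENNReal.ofReal_le_one, hδ]
    rw [div_mul_eq_mul_div, div_le_one (by positivity)]
    linarith
  have hp := moll_pair bump_tendsto A D.Am D.A2 (B.indicator (fun _ => M))
    (memLp_indicator_const 2 hBm M (Or.inr hBf))
  have hp1 : ∀ᶠ k in atTop, ∫⁻ x, ‖moll (bump k) A x - A x‖ₑ * ‖B.indicator (fun _ => M) x‖ₑ ≤ 1 :=
    hp.eventually (ge_mem_nhds (by norm_num) |> fun h => h)
  filter_upwards [hp1, D.comp_unif (GG ε) hGc hδ0] with k h1 h2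
  have hsub : B ⊆ Metric.closedBall x₀ R :=
    ((Metric.ball_subset_ball (by linarith)).trans Metric.ball_subset_closedBall)
  have key : ∀ x ∈ B, ENNReal.ofReal (2 * (‖moll (bump k) A x‖ * ‖GG ε (moll (bump k) g x)‖)) ≤
      2 * (ENNReal.ofReal (‖A x‖ * ‖GG ε (g x)‖) + ‖moll (bump k) A x - A x‖ₑ * ‖B.indicator (fun _ => M) x‖ₑ
        + ENNReal.ofReal δ * ‖A x‖ₑ) := by
    intro x hx
    have e1 : ‖GG ε (moll (bump k) g x)‖ ≤ M := hM _ (by simpa using D.moll_le (bump k) x)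
    have e2 : ‖GG ε (moll (bump k) g x)‖ ≤ ‖GG ε (g x)‖ + δ := by
      have := h2 x (hsub hx)
      rw [dist_eq_norm] at this
      have := norm_sub_norm_le (GG ε (moll (bump k) g x)) (GG ε (g x))
      linarith
    have e3 : ‖moll (bump k) A x‖ ≤ ‖moll (bump k) A x - A x‖ + ‖A x‖ := by
      have := norm_add_le (moll (bump k) A x - A x) (A x)
      simpa using this
    have e4 : 2 * (‖moll (bump k) A x‖ * ‖GG ε (moll (bump k) g x)‖) ≤
        2 * (‖A x‖ * ‖GG ε (g x)‖ + ‖moll (bump k) A x - A x‖ * M + δ * ‖A x‖) := by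
      have a1 := mul_le_mul_of_nonneg_right e3 (norm_nonneg (GG ε (moll (bump k) g x)))
      have a2 := mul_le_mul_of_nonneg_left e1 (norm_nonneg (moll (bump k) A x - A x))
      have a3 := mul_le_mul_of_nonneg_left e2 (norm_nonneg (A x))
      nlinarith
    refine (ENNReal.ofReal_le_ofReal e4).trans ?_
    rw [indicator_of_mem hx, ENNReal.ofReal_mul (by norm_num), ENNReal.ofReal_add (by positivity) (by positivity),
      ENNReal.ofReal_add (by positivity) (by positivity), ENNReal.ofReal_mul (p := ‖moll (bump k) A x - A x‖) (norm_nonneg _),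
      ENNReal.ofReal_mul hδ0.le, ofReal_norm, ofReal_norm, Real.enorm_of_nonneg hM0]
    simp
  have m1 : Measurable (fun x => ‖A x‖ₑ) := D.Am.enorm
  have m2 : Measurable (fun x => ‖moll (bump k) A x - A x‖ₑ * ‖B.indicator (fun _ => M) x‖ₑ) := by
    refine Measurable.mul (f := fun x => ‖moll (bump k) A x - A x‖ₑ) ?_ ?_
    · exact ((D.mollA_cont (bump k)).stronglyMeasurable.sub D.Am).enorm
    · exact (measurable_const.indicator hBm).enorm
  calc _ ≤ ∫⁻ x in B, 2 * (ENNReal.ofReal (‖A x‖ * ‖GG ε (g x)‖)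
          + ‖moll (bump k) A x - A x‖ₑ * ‖B.indicator (fun _ => M) x‖ₑ
        + ENNReal.ofReal δ * ‖A x‖ₑ) := setLIntegral_mono' hBm key
    _ = 2 * ((∫⁻ x in B, ENNReal.ofReal (‖A x‖ * ‖GG ε (g x)‖))
          + (∫⁻ x in B, ‖moll (bump k) A x - A x‖ₑ * ‖B.indicator (fun _ => M) x‖ₑ)
        + ENNReal.ofReal δ * I) := by
        rw [lintegral_const_mul' _ _ (by simp), lintegral_add_right _ (m1.const_mul _),
          lintegral_add_right _ m2, lintegral_const_mul _ m1]
    _ ≤ 2 * (C0 + 1 + 1) := by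
        gcongr
        exact (setLIntegral_le_lintegral _ _).trans h1
    _ = _ := by rw [add_assoc, one_add_one_eq_two]

theorem Data.final (D : Data x₀ R g A) (K : E2 → ℝ) (hK1 : ∀ x, 1 ≤ K x)
    (hK : IntegrableOn K (Metric.closedBall x₀ R) volume)
    (hdist : ∀ᵐ x ∂(volume.restrict (Metric.closedBall x₀ R)), ‖A x‖ ^ 2 ≤ K x * (A x).det)
    (hg0 : g x₀ = 0) {δ : ℝ} (hδ : δ ≤ R / 2)
    (hE : ∀ t, 0 < t → t < δ → ∃ a, dist a x₀ = t ∧ g a = 0) :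
    ∀ z ∈ Metric.ball x₀ δ, g z = 0 := by
  intro z hz
  by_contra hne
  have hzx : z ≠ x₀ := by rintro rfl; exact hne hg0
  have hR := D.hR
  set ρ := ‖z - x₀‖ with hρ
  have hρ0 : 0 < ρ := norm_pos_iff.2 (sub_ne_zero.2 hzx)
  have hρδ : ρ < δ := by rw [hρ, ← dist_eq_norm]; exact hz
  obtain ⟨β, hβ, hzβ⟩ := exists_circlePt (z - x₀)
  rw [← hρ] at hzβ
  have hzz : z = x₀ + circlePt ρ β := by rw [← hzβ]; abel
  set c : ℝ := ‖g z‖ ^ 2 / 2 with hc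
  have hgz : 0 < ‖g z‖ := norm_pos_iff.2 hne
  have hc0 : 0 < c := by positivity
  have hca : ContinuousAt (fun t => ‖g (x₀ + circlePt t β)‖ ^ 2) ρ := by
    have h1 : ContinuousAt g (x₀ + circlePt ρ β) := by
      apply D.gc.continuousAt
      rw [← hzz]
      exact Metric.closedBall_mem_nhds_of_mem (by
        rw [Metric.mem_ball, dist_eq_norm, ← hρ]; linarith)
    have h2 : Continuous (fun t => x₀ + circlePt t β) :=
      continuous_const.add (circlePt_cont.comp (Continuous.prodMk_left β))
    have h3 : ContinuousAt (fun t => g (x₀ + circlePt t β)) ρ :=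
      ContinuousAt.comp (f := fun t => x₀ + circlePt t β) h1 h2.continuousAt
    exact h3.norm.pow 2
  have hev : ∀ᶠ t in 𝓝 ρ, c < ‖g (x₀ + circlePt t β)‖ ^ 2 := by
    apply hca.eventually_const_lt
    beta_reduce
    rw [← hzz, hc]
    nlinarith [sq_nonneg ‖g z‖, pow_pos hgz 2]
  obtain ⟨η, hη, hηc⟩ := Metric.eventually_nhds_iff.1 hev
  set t1 := max (ρ - η) (ρ / 2) with ht1
  have ht10 : 0 < t1 := lt_of_lt_of_le (by positivity) (le_max_right _ _)
  have ht1ρ : t1 < ρ := max_lt (by linarith) (by linarith)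
  obtain ⟨C0, hC0, hC⟩ := D.cacc K hK1 hK hdist
  set L := Real.log (Real.log (1 + 1 / c)) with hL
  obtain ⟨ε, hε, hε1, hbig⟩ := VV_zero_large (L + 2 + (2 * (C0 + 2)) / (ρ - t1))
  have hb := hC ε hε hε1
  have hlim := D.limit_bound hε _ hb
  have hcl := D.comp_unif (VV ε) (VV_contDiff hε).continuous (zero_lt_one)
  have hrk : ∀ᶠ k in atTop, (bump k).rOut < R := bump_tendsto.eventually (gt_mem_nhds hR)
  obtain ⟨k, hk1, hk2, hk3⟩ := (hlim.and (hcl.and hrk)).exists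
  set m := VV ε 0 - L - 2 with hm
  have hmeas : Measurable (fun x => ENNReal.ofReal
      (2 * (‖moll (bump k) A x‖ * ‖GG ε (moll (bump k) g x)‖))) := by
    have c1 := D.mollA_cont (bump k)
    have c2 := (D.moll_contDiff (bump k)).continuous
    have c3 := (GG_contDiff hε).continuous.comp c2
    exact (ENNReal.continuous_ofReal.comp (continuous_const.mul (c1.norm.mul c3.norm))).measurable
  have hpl := polar_lower x₀ _ hmeas (t1 := t1) (t2 := ρ) (r := R / 2) ht10 (by linarith)
    (ENNReal.ofReal m) (by
      intro t ht
      have ht0 : 0 < t := ht10.trans ht.1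
      obtain ⟨a, ha, hga⟩ := hE t ht0 (ht.2.trans hρδ)
      obtain ⟨α, hα, haα⟩ := exists_circlePt (a - x₀)
      rw [← dist_eq_norm, ha] at haα
      have haa : a = x₀ + circlePt t α := by rw [← haα]; abel
      refine le_trans (ENNReal.ofReal_le_ofReal ?_)
        (circle_osc D (bump k) hk3 hε ht0 (by linarith [ht.2]) hβ hα)
      have mem : ∀ θ, x₀ + circlePt t θ ∈ Metric.closedBall x₀ R := by
        intro θ
        simp [circlePt_norm ht0.le]
        linarith [ht.2]
      have q1 := hk2 _ (mem α)
      have q2 := hk2 _ (mem β)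
      rw [← haa, hga, Real.dist_eq, abs_lt] at q1
      rw [Real.dist_eq, abs_lt] at q2
      have q3 : c < ‖g (x₀ + circlePt t β)‖ ^ 2 := by
        apply hηc
        rw [Real.dist_eq, abs_lt]
        have := le_max_left (ρ - η) (ρ / 2)
        constructor <;> linarith [ht.1, ht.2]
      have q4 := VV_le hε hc0 _ q3.le
      rw [← haa]
      linarith [q1.1, q2.2])
  have := hpl.trans hk1
  have hpos : 0 < ρ - t1 := by linarith
  have e2 : (2 : ℝ≥0∞) * (ENNReal.ofReal C0 + 2) = ENNReal.ofReal (2 * (C0 + 2)) := by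
    rw [ENNReal.ofReal_mul (by norm_num), ENNReal.ofReal_add hC0 (by norm_num)]
    simp
  rw [e2, ← ENNReal.ofReal_mul' hpos.le, ENNReal.ofReal_le_ofReal_iff (by positivity)] at this
  have h6 : 2 * (C0 + 2) / (ρ - t1) < m := by linarith
  rw [div_lt_iff₀ hpos] at h6
  linarith

end CF

namespace CF
open Filter

lemma integral_fderiv_zero (φ : E2 → ℝ) (h1 : ContDiff ℝ (⊤ : ℕ∞) φ) (h2 : HasCompactSupport φ)
    (v : E2) : ∫ x, fderiv ℝ φ x v = 0 := by
  have hc : Continuous (fun x => fderiv ℝ φ x v) :=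
    (h1.continuous_fderiv (by simp)).clm_apply continuous_const
  have hi : Integrable (fun x => fderiv ℝ φ x v) volume :=
    hc.integrable_of_hasCompactSupport (h2.fderiv_apply ℝ v)
  have := integral_mul_fderiv_eq_neg_fderiv_mul_of_integrable (μ := volume) (𝕜 := ℝ)
    (f := fun _ : E2 => (1 : ℝ)) (g := φ) (v := v) (by simp) (by simpa using hi)
    (by simpa using h1.continuous.integrable_of_hasCompactSupport h2)
    (fun x _ => differentiableAt_const _) (fun x _ => h1.differentiable (by simp) x)
  simpa using this

lemma mkData {Ω : Set E2} {f : E2 → E2} {Df : E2 → M2}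
    (hcont : ContinuousOn f Ω) (hf : MemW12loc Ω f Df) {x₀ : E2} {R : ℝ} (hR : 0 < R)
    (hsub : Metric.closedBall x₀ (2 * R) ⊆ Ω)
    (h1 : ∀ x ∈ Metric.closedBall x₀ (2 * R), ‖f x - f x₀‖ ≤ 1) :
    Data x₀ R ((Metric.closedBall x₀ (2 * R)).indicator (fun x => f x - f x₀))
      ((Metric.closedBall x₀ (2 * R)).indicator Df) := by
  obtain ⟨-, hDm, hD2, hw⟩ := hf
  set B := Metric.closedBall x₀ (2 * R) with hB
  have hBm : MeasurableSet B := Metric.isClosed_closedBall.measurableSet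
  have hBc : IsCompact B := isCompact_closedBall _ _
  have hfc : ContinuousOn (fun x => f x - f x₀) B := (hcont.mono hsub).sub continuousOn_const
  have hAm : StronglyMeasurable (B.indicator Df) := (hDm.indicator hBm).stronglyMeasurable
  refine ⟨hR, ?_, ?_, ?_, hAm, ?_, ?_⟩
  · rw [aestronglyMeasurable_indicator_iff hBm]
    exact hfc.aestronglyMeasurable hBm
  · exact hfc.congr (fun x hx => by simp [indicator_of_mem hx])
  · intro x
    by_cases hx : x ∈ B
    · rw [indicator_of_mem hx]; exact h1 x hx
    · simp [indicator_of_notMem hx]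
  · refine (memLp_indicator_iff_restrict (f := Df) hBm).2 ?_
    refine ⟨hDm.aestronglyMeasurable, ?_⟩
    rw [eLpNorm_lt_top_iff_lintegral_rpow_enorm_lt_top (by norm_num) (by norm_num)]
    refine lt_of_eq_of_lt ?_ (hD2 B hsub hBc)
    apply lintegral_congr
    intro x
    rw [← ofReal_norm, ENNReal.ofReal_pow (norm_nonneg _)]
    simp
  · intro φ hφ hφc hφs i
    have hφB : tsupport φ ⊆ B := hφs.trans Metric.ball_subset_closedBall
    have z1 : ∀ x, x ∉ B → φ x = 0 := fun x hx =>
      image_eq_zero_of_notMem_tsupport (fun h => hx (hφB h))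
    have z2 : ∀ x, x ∉ B → fderiv ℝ φ x = 0 := fun x hx =>
      image_eq_zero_of_notMem_tsupport (fun h => hx (hφB (tsupport_fderiv_subset ℝ h)))
    have hW := hw φ hφ hφc (hφB.trans hsub) i
    have r1 : ∫ x in Ω, (fderiv ℝ φ x (e i)) • f x = ∫ x in B, (fderiv ℝ φ x (e i)) • f x := by
      rw [setIntegral_eq_integral_of_forall_compl_eq_zero,
        setIntegral_eq_integral_of_forall_compl_eq_zero]
      · intro x hx; simp [z2 x hx]
      · intro x hx; simp [z2 x (fun h => hx (hsub h))]
    have r2 : ∫ x in Ω, φ x • Df x (e i) = ∫ x in B, φ x • Df x (e i) := by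
      rw [setIntegral_eq_integral_of_forall_compl_eq_zero,
        setIntegral_eq_integral_of_forall_compl_eq_zero]
      · intro x hx; simp [z1 x hx]
      · intro x hx; simp [z1 x (fun h => hx (hsub h))]
    have r3 : ∫ x, φ x • (B.indicator Df x) (e i) = ∫ x in B, φ x • Df x (e i) := by
      rw [← integral_indicator hBm]
      congr 1
      ext1 x
      by_cases hx : x ∈ B
      · simp [indicator_of_mem hx]
      · simp [indicator_of_notMem hx]
    have cφ : Continuous (fun x => fderiv ℝ φ x (e i)) :=
      (hφ.continuous_fderiv (by simp)).clm_apply continuous_const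
    have r4 : ∫ x, (fderiv ℝ φ x (e i)) • B.indicator (fun x => f x - f x₀) x =
        ∫ x in B, ((fderiv ℝ φ x (e i)) • f x - (fderiv ℝ φ x (e i)) • f x₀) := by
      rw [← integral_indicator hBm]
      congr 1
      ext1 x
      by_cases hx : x ∈ B
      · simp [indicator_of_mem hx, smul_sub]
      · simp [indicator_of_notMem hx]
    have i1 : IntegrableOn (fun x => (fderiv ℝ φ x (e i)) • f x) B volume :=
      (cφ.continuousOn.smul (hcont.mono hsub)).integrableOn_compact hBc
    have i2 : IntegrableOn (fun x => (fderiv ℝ φ x (e i)) • f x₀) B volume :=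
      (cφ.smul continuous_const).continuousOn.integrableOn_compact hBc
    have r5 : ∫ x in B, (fderiv ℝ φ x (e i)) • f x₀ = 0 := by
      rw [integral_smul_const, setIntegral_eq_integral_of_forall_compl_eq_zero,
        integral_fderiv_zero φ hφ hφc, zero_smul]
      intro x hx; simp [z2 x hx]
    rw [r4, r3, integral_sub i1 i2, r5, sub_zero, ← r1, ← r2]
    exact hW

end CF
/-- **Euclidean case of Proposition 4.1.** Under the logarithmic multiplicity bound,
the component of `x₀` in the fiber `f⁻¹(f(x₀))` is either the singleton `{x₀}` or
contains an open neighborhood of `x₀`. -/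
theorem component_of_fiber
    (Ω : Set E2) (hΩopen : IsOpen Ω)
    (f : E2 → E2) (Df : E2 → E2 →L[ℝ] E2)
    (hcont : ContinuousOn f Ω)
    (hf : MemW12loc Ω f Df)
    (K : E2 → ℝ) (hKmeas : Measurable K) (hK1 : ∀ x, 1 ≤ K x)
    (hKloc : ∀ A : Set E2, A ⊆ Ω → IsCompact A →
      ∫⁻ x in A, ENNReal.ofReal (K x) < ⊤)
    (hdist : ∀ᵐ x ∂(volume.restrict Ω), ‖Df x‖ ^ 2 ≤ K x * (Df x).det)
    (x₀ : E2) (hx₀ : x₀ ∈ Ω)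
    (s : ℝ) (hs : 0 < s) (hball : Metric.closedBall x₀ s ⊆ Ω)
    (r₀ : ℝ) (hr₀ : r₀ ∈ Ioo (0 : ℝ) 1) (C : ℝ) (hC : 0 < C)
    (hmult : ∀ r : ℝ, 0 < r → r < r₀ →
      ∫⁻ θ in Icc (0 : ℝ) (2 * π),
          mult f (Metric.ball x₀ s) (f x₀ + circlePt r θ)
        ≤ ENNReal.ofReal (C * Real.log (1 / r))) :
    connectedComponentIn {x ∈ Ω | f x = f x₀} x₀ = {x₀} ∨
    ∃ U : Set E2, IsOpen U ∧ x₀ ∈ U ∧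
      U ⊆ connectedComponentIn {x ∈ Ω | f x = f x₀} x₀ := by
  classical
  set S := {x ∈ Ω | f x = f x₀} with hS
  have hxS : x₀ ∈ S := ⟨hx₀, rfl⟩
  by_cases hsing : connectedComponentIn S x₀ = {x₀}
  · exact Or.inl hsing
  right
  have hmem : x₀ ∈ connectedComponentIn S x₀ := mem_connectedComponentIn hxS
  obtain ⟨x₁, hx₁, hne⟩ : ∃ x₁ ∈ connectedComponentIn S x₀, x₁ ≠ x₀ := by
    by_contra hcon
    push Not at hcon
    exact hsing (Subset.antisymm (fun x hx => hcon x hx) (singleton_subset_iff.2 hmem))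
  -- a small closed ball on which `f` stays close to `f x₀`
  obtain ⟨R, hR, hRΩ, hR1⟩ : ∃ R : ℝ, 0 < R ∧ Metric.closedBall x₀ (2 * R) ⊆ Ω ∧
      ∀ x ∈ Metric.closedBall x₀ (2 * R), ‖f x - f x₀‖ ≤ 1 := by
    have hca : ContinuousAt f x₀ := hcont.continuousAt (hΩopen.mem_nhds hx₀)
    have h1 : ∀ᶠ x in 𝓝 x₀, x ∈ Ω ∧ dist (f x) (f x₀) < 1 :=
      Filter.Eventually.and (hΩopen.mem_nhds hx₀)
        (hca (Metric.ball_mem_nhds (f x₀) one_pos))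
    obtain ⟨η, hη, H⟩ := Metric.eventually_nhds_iff.1 h1
    refine ⟨η / 4, by positivity, fun x hx => (H ?_).1, fun x hx => ?_⟩
    · rw [Metric.mem_closedBall] at hx; linarith
    · rw [← dist_eq_norm]
      refine (H ?_).2.le
      rw [Metric.mem_closedBall] at hx; linarith
  have D := CF.mkData hcont hf hR hRΩ hR1
  have hRsub : Metric.closedBall x₀ R ⊆ Metric.closedBall x₀ (2 * R) :=
    Metric.closedBall_subset_closedBall (by linarith)
  have hK : IntegrableOn K (Metric.closedBall x₀ R) volume := by
    refine ⟨hKmeas.aestronglyMeasurable, ?_⟩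
    refine lt_of_eq_of_lt ?_ (hKloc _ (hRsub.trans hRΩ) (isCompact_closedBall _ _))
    apply lintegral_congr
    intro x
    rw [Real.enorm_of_nonneg (by linarith [hK1 x])]
  have hd : ∀ᵐ x ∂(volume.restrict (Metric.closedBall x₀ R)),
      ‖(Metric.closedBall x₀ (2 * R)).indicator Df x‖ ^ 2 ≤
        K x * ((Metric.closedBall x₀ (2 * R)).indicator Df x).det := by
    filter_upwards [ae_restrict_of_ae_restrict_of_subset (hRsub.trans hRΩ) hdist,
      ae_restrict_mem Metric.isClosed_closedBall.measurableSet] with x hx hxm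
    rw [indicator_of_mem (hRsub hxm)]
    exact hx
  set d := dist x₁ x₀ with hd_def
  have hdpos : 0 < d := dist_pos.2 hne
  have hpre : IsPreconnected (connectedComponentIn S x₀) := isPreconnected_connectedComponentIn
  have hlev : ∀ t, 0 < t → t < d → ∃ a ∈ connectedComponentIn S x₀, dist a x₀ = t := by
    intro t ht htd
    have hi := hpre.intermediate_value hmem hx₁ (f := fun x => dist x x₀) (by fun_prop)
    obtain ⟨a, ha, hat⟩ := hi ⟨by simpa using ht.le, htd.le⟩
    exact ⟨a, ha, hat⟩
  set δ := min d (R / 2) with hδ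
  have hδ0 : 0 < δ := lt_min hdpos (by positivity)
  have hδR : δ ≤ R / 2 := min_le_right _ _
  have hzero := D.final K hK1 hK hd (by simp [indicator]) (δ := δ) hδR (by
    intro t ht htδ
    obtain ⟨a, ha, hat⟩ := hlev t ht (htδ.trans_le (min_le_left _ _))
    refine ⟨a, hat, ?_⟩
    have haS : a ∈ S := connectedComponentIn_subset _ _ ha
    have ham : a ∈ Metric.closedBall x₀ (2 * R) := by
      rw [Metric.mem_closedBall, hat]; linarith
    rw [indicator_of_mem ham, haS.2, sub_self])
  refine ⟨Metric.ball x₀ δ, Metric.isOpen_ball, Metric.mem_ball_self hδ0, ?_⟩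
  apply (convex_ball x₀ δ).isPreconnected.subset_connectedComponentIn (Metric.mem_ball_self hδ0)
  intro z hz
  have hzm : z ∈ Metric.closedBall x₀ (2 * R) := by
    rw [Metric.mem_closedBall]; rw [Metric.mem_ball] at hz; linarith
  have h0 := hzero z hz
  rw [indicator_of_mem hzm] at h0
  exact ⟨hRΩ hzm, sub_eq_zero.1 h0⟩
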